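/- arXiv:2409.15075 — 8 statements merged into one kernel-verified Lean document; each statement's English description precedes it below -/
import Mathlib

section
/- Let n and k be positive integers and let a_1, a_2, ..., a_k be positive integers. Then the number of integers m such that the number of k-tuples (j_1, ..., j_k) with each j_i in {1, 2, ..., n} and j_1*a_1 + j_2*a_2 + ... + j_k*a_k = m is odd, is at least n. (Equivalently, |{a_1, 2a_1, ..., na_1} ⊕ ... ⊕ {a_k, 2a_k, ..., na_k}| ≥ n.) -/
open Polynomial in
theorem pilz_aux_expand_card (F : Type*) [Field F] (n : ℕ) (hn : 0 < n) (U : F[X]) :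
    (expand F n U).support.card ≤ U.support.card := by
  have : (expand F n U).support ⊆ U.support.image (fun i => i * n) := by
    intro i hi
    rw [mem_support_iff, coeff_expand hn] at hi
    split_ifs at hi with h
    · rw [Finset.mem_image]
      exact ⟨i / n, mem_support_iff.2 hi, Nat.div_mul_cancel h⟩
    · exact absurd rfl hi
  exact (Finset.card_le_card this).trans Finset.card_image_le

open Polynomial in
theorem pilz_aux_lower (F : Type*) [Field F] (M N : ℕ) (hM : 0 < M) (Q R U : F[X])
    (hU : U * Q = expand F M Q) (hR : Q * R = X ^ N - 1) (hdeg : R.natDegree < N) :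
    M ≤ N * U.support.card := by
  have hN : 0 < N := by omega
  have h0 : Q.coeff 0 * R.coeff 0 = -1 := by
    rw [← mul_coeff_zero, hR]
    simp [coeff_X_pow, hN.ne]
  have key : U * (X ^ N - 1) = C (Q.coeff 0) * R + X ^ M * (expand F M (divX Q) * R) := by
    have e : expand F M Q = expand F M (divX Q) * X ^ M + C (Q.coeff 0) := by
      conv_lhs => rw [← divX_mul_X_add Q]
      simp
    rw [← hR, ← mul_assoc, hU, e]
    ring
  have hc : ∀ i, i < M → (U * (X ^ N - 1)).coeff i = Q.coeff 0 * R.coeff i := by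
    intro i hi
    rw [key, coeff_add, coeff_C_mul, coeff_X_pow_mul', if_neg (by omega), add_zero]
  have hne : ∀ j, N * j < M → U.coeff (N * j) ≠ 0 := by
    intro j
    induction j with
    | zero =>
      intro h
      have := hc _ h
      rw [mul_sub, coeff_sub, mul_one, coeff_mul_X_pow', Nat.mul_zero, if_neg (by omega), h0] at this
      intro h'
      rw [Nat.mul_zero] at h'
      simp [h'] at this
    | succ j ih =>
      intro h
      have := hc _ h
      rw [mul_sub, coeff_sub, mul_one, coeff_mul_X_pow',
        if_pos (by rw [Nat.mul_succ]; omega),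
        coeff_eq_zero_of_natDegree_lt (p := R) (by rw [Nat.mul_succ]; omega), mul_zero,
        Nat.mul_succ, Nat.add_sub_cancel, sub_eq_zero] at this
      rw [Nat.mul_succ, ← this]
      exact ih (by rw [Nat.mul_succ] at h; omega)
  by_contra! hlt
  have hsub : (Finset.range (U.support.card + 1)).image (fun j => N * j) ⊆ U.support := by
    intro i hi
    rw [Finset.mem_image] at hi
    obtain ⟨j, hj, rfl⟩ := hi
    rw [Finset.mem_range] at hj
    refine mem_support_iff.2 (hne j (lt_of_le_of_lt (Nat.mul_le_mul_left N ?_) hlt))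
    omega
  have := Finset.card_le_card hsub
  rw [Finset.card_image_of_injective _ (fun x y h => Nat.eq_of_mul_eq_mul_left hN h), Finset.card_range] at this
  omega

open Polynomial in
theorem pilz_aux_main (F : Type*) [Field F] (n N : ℕ) (hn : 0 < n) (Q R P : F[X])
    (hP : P * Q = expand F n Q) (hR : Q * R = X ^ N - 1) (hdeg : R.natDegree < N) :
    n ≤ P.support.card := by
  have hU : ∀ m : ℕ, ∃ U : F[X], U * Q = expand F (n ^ m) Q ∧
      U.support.card ≤ P.support.card ^ m := by
    intro m
    induction m with
    | zero => exact ⟨1, by simp, by simpa using card_support_C_mul_X_pow_le_one (c := (1:F)) (n := 0)⟩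
    | succ m ih =>
      obtain ⟨U, h1, h2⟩ := ih
      refine ⟨expand F n U * P, ?_, ?_⟩
      · rw [mul_assoc, hP, ← map_mul, h1, expand_expand, pow_succ']
      · refine card_support_mul_le.trans ?_
        rw [pow_succ]
        exact Nat.mul_le_mul_right _ ((pilz_aux_expand_card F n hn U).trans h2)
  have hb : ∀ m, n ^ m ≤ N * P.support.card ^ m := by
    intro m
    obtain ⟨U, h1, h2⟩ := hU m
    exact (pilz_aux_lower F _ N (by positivity) Q R U h1 hR hdeg).trans (Nat.mul_le_mul_left _ h2)
  generalize P.support.card = w at hb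
  by_contra! hlt
  rcases Nat.eq_zero_or_pos w with rfl | hw
  · have := hb 1
    simp at this
    omega
  · have h1 := hb (N * w)
    have h2 : (w + 1) ^ (N * w) ≤ n ^ (N * w) := Nat.pow_le_pow_left hlt _
    have h3 : ((w:ℝ) + 1) ^ (N * w) ≤ N * w ^ (N * w) := by exact_mod_cast h2.trans h1
    have hw' : (0:ℝ) < w := by exact_mod_cast hw
    have h4 := one_add_mul_le_pow (a := 1 / (w:ℝ)) (by have : 0 < 1 / (w:ℝ) := by positivity
                                                       linarith) (N * w)
    have h5 : (1 + 1 / (w:ℝ)) ^ (N * w) * w ^ (N * w) = (w + 1) ^ (N * w) := by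
      rw [← mul_pow]; congr 1; field_simp
    have h6 : 1 + ((N * w : ℕ) : ℝ) * (1 / (w:ℝ)) = 1 + N := by push_cast; field_simp
    rw [h6] at h4
    have h7 : (0:ℝ) < w ^ (N * w) := by positivity
    nlinarith

open Polynomial in
/-- Sumset variant of Pilz's conjecture: the symmetric-difference sumset
`{a₁,2a₁,…,na₁} ⊕ ⋯ ⊕ {a_k,2a_k,…,na_k}` (elements represented an odd number
of times) has at least `n` elements. -/
theorem pilz_sumset_variant (n k : ℕ) (hn : 0 < n) (hk : 0 < k)
    (a : Fin k → ℕ) (ha : ∀ i, 0 < a i) :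
    n ≤ Set.ncard {m : ℕ |
      Odd (((Fintype.piFinset fun _ : Fin k => Finset.Icc 1 n).filter
        (fun j => ∑ i, j i * a i = m)).card)} := by
  haveI : Fact (Nat.Prime 2) := ⟨Nat.prime_two⟩
  set P1 : (ZMod 2)[X] := ∏ i, ∑ j ∈ Finset.Icc 1 n, X ^ (j * a i) with hP1
  set P : (ZMod 2)[X] := ∏ i, ∑ j ∈ Finset.range n, (X ^ a i) ^ j with hP
  set Q : (ZMod 2)[X] := ∏ i, (X ^ a i - 1) with hQ
  have hset : {m : ℕ | Odd (((Fintype.piFinset fun _ : Fin k => Finset.Icc 1 n).filter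
        (fun j => ∑ i, j i * a i = m)).card)} = (P1.support : Set ℕ) := by
    ext m
    rw [Set.mem_setOf_eq, Finset.mem_coe, mem_support_iff, hP1, Finset.prod_univ_sum]
    simp only [Finset.prod_pow_eq_pow_sum, finset_sum_coeff, coeff_X_pow]
    rw [Finset.sum_boole, ZMod.natCast_ne_zero_iff_odd]
    simp only [eq_comm]
  rw [hset, Set.ncard_coe_finset]
  have hPP : P1 = X ^ (∑ i, a i) * P := by
    rw [hP1, hP, ← Finset.prod_pow_eq_pow_sum, ← Finset.prod_mul_distrib]
    refine Finset.prod_congr rfl fun i _ => ?_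
    rw [Finset.mul_sum, Finset.sum_bij (fun j _ => j - 1)]
    · intro j hj; simp at hj ⊢; omega
    · intro j hj l hl h; simp at hj hl; omega
    · intro j hj; exact ⟨j + 1, by simp at hj ⊢; omega, by simp⟩
    · intro j hj
      obtain ⟨hj, _⟩ := Finset.mem_Icc.1 hj
      obtain ⟨l, rfl⟩ := Nat.exists_eq_add_of_le hj
      rw [← pow_mul, ← pow_add]
      congr 1
      rw [Nat.add_sub_cancel_left]; ring
  have hcard : P.support.card ≤ P1.support.card := by
    refine Finset.card_le_card_of_injOn (fun i => i + ∑ i, a i) ?_ ?_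
    · intro i hi
      simp only [Finset.mem_coe, mem_support_iff] at hi ⊢
      rwa [hPP, coeff_X_pow_mul]
    · intro i _ j _ h
      simpa using h
  refine le_trans ?_ hcard
  set A := ∏ i, a i with hA
  have hApos : 0 < A := Finset.prod_pos fun i _ => ha i
  have hdvd : Q ∣ X ^ (A * 2 ^ k) - 1 := by
    have h1 : Q ∣ (X ^ A - 1) ^ k := by
      have : ((X : (ZMod 2)[X]) ^ A - 1) ^ k = ∏ _i : Fin k, (X ^ A - 1) := by simp
      rw [this, hQ]
      refine Finset.prod_dvd_prod_of_dvd _ _ fun i _ => ?_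
      obtain ⟨c, hc⟩ := Finset.dvd_prod_of_mem a (Finset.mem_univ i)
      rw [hA, hc, pow_mul]
      exact sub_one_dvd_pow_sub_one _ _
    refine h1.trans ((pow_dvd_pow _ (Nat.lt_two_pow_self (n := k)).le).trans ?_)
    rw [sub_pow_char_pow, pow_mul, one_pow]
  obtain ⟨R, hR⟩ := hdvd
  have hN : 0 < A * 2 ^ k := by positivity
  have hne : (X : (ZMod 2)[X]) ^ (A * 2 ^ k) - 1 ≠ 0 := (monic_X_pow_sub_C (1 : ZMod 2) hN.ne').ne_zero
  have hnd : ((X : (ZMod 2)[X]) ^ (A * 2 ^ k) - 1).natDegree = A * 2 ^ k :=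
    natDegree_X_pow_sub_C (r := (1 : ZMod 2))
  refine pilz_aux_main (ZMod 2) n (A * 2 ^ k) hn Q R P ?_ hR.symm ?_
  · rw [hP, hQ, ← Finset.prod_mul_distrib, map_prod]
    refine Finset.prod_congr rfl fun i _ => ?_
    rw [geom_sum_mul]
    simp [← pow_mul, mul_comm]
  · rw [hR] at hne hnd
    rw [natDegree_mul (left_ne_zero_of_mul hne) (right_ne_zero_of_mul hne)] at hnd
    have hQd : Q.natDegree = ∑ i, a i := by
      rw [hQ, natDegree_prod_of_monic Finset.univ (fun i => (X : (ZMod 2)[X]) ^ a i - 1) fun i _ =>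
        monic_X_pow_sub_C (1 : ZMod 2) (ha i).ne']
      exact Finset.sum_congr rfl fun i _ => natDegree_X_pow_sub_C (r := (1 : ZMod 2))
    have : 0 < ∑ i, a i := Finset.sum_pos (fun i _ => ha i) ⟨⟨0, hk⟩, Finset.mem_univ _⟩
    omega
end

section
/- Let n and k be positive integers, let a_1, ..., a_k be positive integers, and let V be a finite nonempty set of positive integers of odd cardinality. Then the number of integers m such that the number of tuples (v, j_1, ..., j_k) with v ∈ V, each j_i ∈ {1, 2, ..., n}, and v + j_1*a_1 + ... + j_k*a_k = m is odd, is at least n. (Equivalently, |V ⊕ {a_1, 2a_1, ..., na_1} ⊕ ... ⊕ {a_k, 2a_k, ..., na_k}| ≥ n.) -/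
open Polynomial

namespace PilzAux

/-- number of ones in binary -/
def bc : ℕ → ℕ
  | 0 => 0
  | n + 1 => (n + 1) % 2 + bc ((n + 1) / 2)
decreasing_by omega

lemma bc_eq (n : ℕ) : bc n = n % 2 + bc (n / 2) := by
  cases n with
  | zero => simp [bc]
  | succ n => rw [bc]

lemma bc_zero : bc 0 = 0 := by simp [bc]

lemma bc_two_mul (n : ℕ) : bc (2 * n) = bc n := by
  rw [bc_eq]
  have h1 : 2 * n % 2 = 0 := by omega
  have h2 : 2 * n / 2 = n := by omega
  rw [h1, h2]; omega

lemma bc_two_mul_add (n : ℕ) : bc (2 * n + 1) = bc n + 1 := by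
  rw [bc_eq]
  have h1 : (2 * n + 1) % 2 = 1 := by omega
  have h2 : (2 * n + 1) / 2 = n := by omega
  rw [h1, h2]; omega

lemma bc_succ_le (n : ℕ) : bc (n + 1) ≤ bc n + 1 := by
  induction n using Nat.strong_induction_on with
  | _ n ih =>
    rcases Nat.even_or_odd' n with ⟨c, rfl | rfl⟩
    · rw [bc_two_mul_add, bc_two_mul]
    · have h : 2 * c + 1 + 1 = 2 * (c + 1) := by ring
      rw [h, bc_two_mul, bc_two_mul_add]
      have := ih c (by omega)
      omega

lemma bc_add_le (a b : ℕ) : bc (a + b) ≤ bc a + bc b := by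
  induction a using Nat.strong_induction_on generalizing b with
  | _ a ih =>
    by_cases ha : a = 0
    · subst ha; simp
    rcases Nat.even_or_odd' a with ⟨c, rfl | rfl⟩ <;>
    rcases Nat.even_or_odd' b with ⟨d, rfl | rfl⟩
    · have h : 2 * c + 2 * d = 2 * (c + d) := by ring
      rw [h, bc_two_mul, bc_two_mul, bc_two_mul]
      exact ih c (by omega) d
    · have h : 2 * c + (2 * d + 1) = 2 * (c + d) + 1 := by ring
      rw [h, bc_two_mul_add, bc_two_mul, bc_two_mul_add]
      have := ih c (by omega) d
      omega
    · have h : 2 * c + 1 + 2 * d = 2 * (c + d) + 1 := by ring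
      rw [h, bc_two_mul_add, bc_two_mul, bc_two_mul_add]
      have := ih c (by omega) d
      omega
    · have h : 2 * c + 1 + (2 * d + 1) = 2 * (c + d + 1) := by ring
      rw [h, bc_two_mul, bc_two_mul_add, bc_two_mul_add]
      have := ih c (by omega) d
      have := bc_succ_le (c + d)
      omega

lemma bc_split (s A B : ℕ) (hB : B < 2 ^ s) : bc (2 ^ s * A + B) = bc A + bc B := by
  induction s generalizing B with
  | zero =>
    have : B = 0 := by simpa using hB
    subst this; simp [bc_zero]
  | succ s ih =>
    have hp : 2 ^ (s + 1) = 2 * 2 ^ s := by ring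
    rw [hp] at hB ⊢
    rcases Nat.even_or_odd' B with ⟨c, rfl | rfl⟩
    · have h : 2 * 2 ^ s * A + 2 * c = 2 * (2 ^ s * A + c) := by ring
      rw [h, bc_two_mul, bc_two_mul, ih c (by omega)]
    · have h : 2 * 2 ^ s * A + (2 * c + 1) = 2 * (2 ^ s * A + c) + 1 := by ring
      rw [h, bc_two_mul_add, bc_two_mul_add, ih c (by omega)]
      omega

lemma bc_pow_sub (s : ℕ) : bc (2 ^ s - 1) = s := by
  induction s with
  | zero => simp [bc_zero]
  | succ s ih =>
    have hp : 2 ^ (s + 1) - 1 = 2 * (2 ^ s - 1) + 1 := by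
      have := Nat.one_le_two_pow (n := s)
      rw [pow_succ]; omega
    rw [hp, bc_two_mul_add, ih]

lemma le_bc (s N : ℕ) (hN : 0 < N) (hd : 2 ^ s - 1 ∣ N) : s ≤ bc N := by
  induction N using Nat.strong_induction_on with
  | _ N ih =>
    have h1 := Nat.one_le_two_pow (n := s)
    by_cases hs : s = 0
    · omega
    have h2 : 2 ≤ 2 ^ s := by
      calc 2 = 2 ^ 1 := by norm_num
        _ ≤ 2 ^ s := Nat.pow_le_pow_right (by norm_num) (by omega)
    by_cases hlt : N < 2 ^ s
    · have := Nat.le_of_dvd hN hd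
      have : N = 2 ^ s - 1 := by omega
      rw [this, bc_pow_sub]
    · have hdm := Nat.div_add_mod N (2 ^ s)
      have hB := Nat.mod_lt N (show 2 ^ s > 0 by omega)
      have hA : 0 < N / 2 ^ s := Nat.div_pos (by omega) (by omega)
      generalize N / 2 ^ s = A at *
      generalize N % 2 ^ s = B at *
      have hlt2 : A + B < N := by nlinarith
      have hd2 : 2 ^ s - 1 ∣ A + B := by
        have hN2 : N = (2 ^ s - 1) * A + (A + B) := by
          rw [← hdm]
          obtain ⟨q, hq⟩ : ∃ q, 2 ^ s = q + 1 := ⟨2 ^ s - 1, by omega⟩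
          rw [hq]; simp; ring
        rw [hN2] at hd
        exact (Nat.dvd_add_right (Dvd.intro _ rfl)).1 hd
      have := ih (A + B) hlt2 (by omega) hd2
      rw [← hdm, bc_split s A B hB]
      exact this.trans (bc_add_le A B)

/-- folded coefficient -/
noncomputable def fc (D : ℕ) (r : ℕ) : (ZMod 2)[X] →+ ZMod 2 where
  toFun P := P.sum fun j b => if j % D = r % D then b else 0
  map_zero' := by simp
  map_add' P Q := by
    apply sum_add_index
    · intro i; simp
    · intro i b c; split_ifs <;> simp

lemma fc_monomial (D r j : ℕ) (b : ZMod 2) :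
    fc D r (monomial j b) = if j % D = r % D then b else 0 := by
  change (monomial j b).sum (fun i c => if i % D = r % D then c else 0) = _
  rw [sum_monomial_index]; simp

lemma fc_add_self (D r : ℕ) (P : (ZMod 2)[X]) : fc D (r + D) P = fc D r P := by
  simp [fc]

lemma fc_shift (D r a : ℕ) (P : (ZMod 2)[X]) : fc D (r + a) (X ^ a * P) = fc D r P := by
  induction P using Polynomial.induction_on' with
  | add p q hp hq => rw [mul_add, map_add, map_add, hp, hq]
  | monomial j b =>
    rw [X_pow_mul_monomial, fc_monomial, fc_monomial]
    congr 1
    exact propext ⟨fun h => Nat.ModEq.add_right_cancel' a h, fun h => Nat.ModEq.add_right a h⟩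

lemma fc_double (D r : ℕ) (hD : 0 < D) (P : (ZMod 2)[X]) :
    fc D r P = fc (2 * D) r P + fc (2 * D) (r + D) P := by
  induction P using Polynomial.induction_on' with
  | add p q hp hq => rw [map_add, map_add, map_add, hp, hq]; ring
  | monomial j b =>
    rw [fc_monomial, fc_monomial, fc_monomial]
    have e : ∀ x, x % (2 * D) = x % D + D * (x / D % 2) := by
      intro x; rw [mul_comm 2 D, Nat.mod_mul]
    have e2 : (r + D) / D = r / D + 1 := Nat.add_div_right r hD
    rw [e, e, e, e2, Nat.add_mod_right]
    have hj := Nat.mod_lt j hD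
    have hr := Nat.mod_lt r hD
    rcases Nat.mod_two_eq_zero_or_one (j / D) with h1 | h1 <;>
    rcases Nat.mod_two_eq_zero_or_one (r / D) with h2 | h2
    · have h3 : (r / D + 1) % 2 = 1 := by omega
      rw [h1, h2, h3]; split_ifs <;> first | omega | simp
    · have h3 : (r / D + 1) % 2 = 0 := by omega
      rw [h1, h2, h3]; split_ifs <;> first | omega | simp
    · have h3 : (r / D + 1) % 2 = 1 := by omega
      rw [h1, h2, h3]; split_ifs <;> first | omega | simp
    · have h3 : (r / D + 1) % 2 = 0 := by omega
      rw [h1, h2, h3]; split_ifs <;> first | omega | simp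

lemma fc_mul_sub (D r : ℕ) (P : (ZMod 2)[X]) : fc D r ((X ^ D - 1) * P) = 0 := by
  rw [sub_mul, one_mul, map_sub, ← fc_add_self, fc_shift, sub_self]

lemma sum_fc (D : ℕ) (hD : 0 < D) (P : (ZMod 2)[X]) :
    ∑ r ∈ Finset.range D, fc D r P = P.eval 1 := by
  induction P using Polynomial.induction_on' with
  | add p q hp hq => simp only [map_add, Finset.sum_add_distrib, hp, hq, eval_add]
  | monomial j b =>
    rw [eval_monomial]
    simp only [one_pow, mul_one, fc_monomial]
    rw [Finset.sum_eq_single (j % D)]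
    · simp
    · intro r hr hne
      rw [Nat.mod_eq_of_lt (Finset.mem_range.1 hr), if_neg (Ne.symm hne)]
    · intro h; exact absurd (Finset.mem_range.2 (Nat.mod_lt j hD)) h

/-- folded weight -/
noncomputable def W (D : ℕ) (P : (ZMod 2)[X]) : ℕ :=
  ((Finset.range D).filter fun r => fc D r P ≠ 0).card

lemma card_range_mul_periodic (p : ℕ → Prop) [DecidablePred p] (g m : ℕ)
    (hp : ∀ r, p (r + g) ↔ p r) :
    ((Finset.range (m * g)).filter p).card = m * ((Finset.range g).filter p).card := by
  have hp2 : ∀ m r, p (m * g + r) ↔ p r := by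
    intro m
    induction m with
    | zero => intro r; simp
    | succ m ih => intro r; rw [← ih r, ← hp (m * g + r)]; ring_nf
  rw [← Nat.count_eq_card_filter_range, ← Nat.count_eq_card_filter_range]
  induction m with
  | zero => simp
  | succ m ih =>
    rw [add_mul, one_mul, Nat.count_add, ih]
    simp only [hp2]; ring

lemma W_le_double (D : ℕ) (hD : 0 < D) (P : (ZMod 2)[X]) : W D P ≤ W (2 * D) P := by
  unfold W
  apply Finset.card_le_card_of_surjOn (fun j => j % D)
  intro r hr
  simp only [Finset.coe_filter, Finset.mem_range, Set.mem_setOf_eq] at hr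
  obtain ⟨h1, h2⟩ := hr
  rw [fc_double D r hD] at h2
  simp only [Set.mem_image, Finset.coe_filter, Finset.mem_range, Set.mem_setOf_eq]
  by_cases h : fc (2 * D) r P = 0
  · exact ⟨r + D, ⟨by omega, by simpa [h] using h2⟩, by simp [Nat.mod_eq_of_lt h1]⟩
  · exact ⟨r, ⟨by omega, h⟩, Nat.mod_eq_of_lt h1⟩

lemma W_odd (D : ℕ) (hD : 0 < D) (P : (ZMod 2)[X]) :
    W (2 * D) ((X ^ D - 1) * P) = 2 * W D P := by
  have key : ∀ r, fc (2 * D) r ((X ^ D - 1) * P) = fc D r P := by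
    intro r
    have h1 : fc (2 * D) r (X ^ D * P) = fc (2 * D) (r + D) P := by
      rw [← fc_shift (2 * D) (r + D) D, ← fc_add_self]
      congr 2; ring
    rw [sub_mul, one_mul, map_sub, h1, fc_double D r hD, CharTwo.sub_eq_add, add_comm]
  unfold W
  simp only [key]
  apply card_range_mul_periodic
  intro r; rw [fc_add_self]

lemma W_le (D : ℕ) (P : (ZMod 2)[X]) : W D P ≤ P.support.card := by
  unfold W
  apply Finset.card_le_card_of_surjOn (fun j => j % D)
  intro r hr
  simp only [Finset.coe_filter, Finset.mem_range, Set.mem_setOf_eq] at hr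
  obtain ⟨h1, h2⟩ := hr
  obtain ⟨j, hj, hne⟩ := Finset.exists_ne_zero_of_sum_ne_zero
    (show ∑ j ∈ P.support, (if j % D = r % D then P.coeff j else 0) ≠ 0 from h2)
  refine ⟨j, hj, ?_⟩
  rw [Nat.mod_eq_of_lt h1] at hne
  by_contra h
  exact hne (if_neg h)

lemma weight (f : ℕ) : ∀ (D : ℕ) (_ : 0 < D) (R : (ZMod 2)[X]),
    2 ^ bc f * W D R ≤ ((X ^ D - 1) ^ f * R).support.card := by
  induction f using Nat.strong_induction_on with
  | _ f ih =>
    intro D hD R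
    by_cases hf : f = 0
    · subst hf; simpa [bc_zero] using W_le D R
    have hsq : (X ^ D - 1 : (ZMod 2)[X]) ^ 2 = X ^ (2 * D) - 1 := by
      rw [sub_pow_char, one_pow, ← pow_mul, mul_comm]
    rcases Nat.even_or_odd' f with ⟨c, rfl | rfl⟩
    · rw [bc_two_mul, pow_mul, hsq]
      exact (Nat.mul_le_mul_left _ (W_le_double D hD R)).trans
        (ih c (by omega) (2 * D) (by omega) R)
    · rw [bc_two_mul_add, pow_succ, pow_succ (X ^ D - 1 : (ZMod 2)[X]), pow_mul, hsq, mul_assoc,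
        mul_assoc, ← W_odd D hD]
      exact ih c (by omega) (2 * D) (by omega) _

lemma periodic_gcd (f : ℕ → ZMod 2) (p q : ℕ) :
    Function.Periodic f p → Function.Periodic f q → Function.Periodic f (Nat.gcd p q) := by
  induction p, q using Nat.gcd.induction with
  | H0 n => intro _ h; simpa using h
  | H1 m n hm ih =>
    intro h1 h2
    rw [Nat.gcd_rec]
    refine ih ?_ h1
    intro r
    have h3 := (h1.nat_mul (n / m)) (r + n % m)
    rw [← h3, ← h2 r]
    congr 1
    have := Nat.div_add_mod n m
    simp only [Nat.cast_id]
    nlinarith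

lemma factor (n s m a v b g : ℕ) (hn : n = 2 ^ s * m) (hm : Odd m) (ha : a = 2 ^ v * b)
    (hb : Odd b) (hg : g ∣ b) :
    ∃ E : (ZMod 2)[X], ∑ j ∈ Finset.Icc 1 n, X ^ (j * a) =
      (X ^ (m * g) - 1) ^ ((2 ^ s - 1) * 2 ^ v) * E ∧ E.eval 1 = 1 ∧
      (X ^ (m * g) - 1) ∣ (X ^ b - 1) * E := by
  obtain ⟨c, rfl⟩ := hg
  have hbpos : 0 < g * c := hb.pos
  have hc : Odd c := (Nat.odd_mul.1 hb).2
  set y : (ZMod 2)[X] := X ^ (m * g) - 1 with hy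
  let Q : (ZMod 2)[X] := ∑ j ∈ Finset.range c, (X ^ (m * g)) ^ j
  let H : (ZMod 2)[X] := ∑ j ∈ Finset.range m, (X ^ (g * c)) ^ j
  have hQ : y * Q = X ^ (m * (g * c)) - 1 := by
    rw [hy, mul_geom_sum, ← pow_mul, mul_assoc]
  have hH : (X ^ (g * c) - 1) * H = X ^ (m * (g * c)) - 1 := by
    rw [mul_geom_sum, ← pow_mul, mul_comm m]
  have hne : (X ^ a - 1 : (ZMod 2)[X]) ≠ 0 := by
    apply X_pow_sub_C_ne_zero (a := (1 : ZMod 2))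
    rw [ha]; positivity
  have hgeom : ∑ j ∈ Finset.range n, (X ^ a : (ZMod 2)[X]) ^ j =
      ((y * Q) ^ (2 ^ s - 1) * H) ^ 2 ^ v := by
    apply mul_left_cancel₀ hne
    rw [mul_geom_sum]
    have e1 : (X ^ a - 1 : (ZMod 2)[X]) = (X ^ (g * c) - 1) ^ 2 ^ v := by
      rw [sub_pow_char_pow, one_pow, ← pow_mul, ha, mul_comm]
    have e2 : ((X ^ a) ^ n - 1 : (ZMod 2)[X]) = ((X ^ (m * (g * c)) - 1) ^ 2 ^ s) ^ 2 ^ v := by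
      rw [← pow_mul, ← pow_mul, ← pow_add, sub_pow_char_pow, one_pow, ← pow_mul, ha, hn, pow_add]
      congr 2; ring
    rw [e1, e2, ← mul_pow]
    congr 1
    calc (X ^ (m * (g * c)) - 1 : (ZMod 2)[X]) ^ 2 ^ s
        = (X ^ (m * (g * c)) - 1) ^ (2 ^ s - 1 + 1) := by
          rw [Nat.sub_add_cancel Nat.one_le_two_pow]
      _ = (y * Q) ^ (2 ^ s - 1) * ((X ^ (g * c) - 1) * H) := by rw [pow_succ, hQ, hH]
      _ = _ := by ring
  have hQ1 : Q.eval 1 = 1 := by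
    simp only [Q, eval_finset_sum, eval_pow, eval_X, one_pow, Finset.sum_const, Finset.card_range,
      nsmul_eq_mul, mul_one]
    exact ZMod.natCast_eq_one_iff_odd.2 hc
  have hH1 : H.eval 1 = 1 := by
    simp only [H, eval_finset_sum, eval_pow, eval_X, one_pow, Finset.sum_const, Finset.card_range,
      nsmul_eq_mul, mul_one]
    exact ZMod.natCast_eq_one_iff_odd.2 hm
  refine ⟨X ^ a * (Q ^ (2 ^ s - 1) * H) ^ 2 ^ v, ?_, ?_, ?_⟩
  · have h1 : ∑ j ∈ Finset.Icc 1 n, (X ^ (j * a) : (ZMod 2)[X]) =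
        X ^ a * ∑ j ∈ Finset.range n, (X ^ a : (ZMod 2)[X]) ^ j := by
      rw [Finset.mul_sum, Finset.range_eq_Ico, ← Finset.Ico_add_one_right_eq_Icc,
        ← Finset.sum_Ico_add' _ 0 n 1]
      refine Finset.sum_congr rfl fun j _ => ?_
      ring
    rw [h1, hgeom, pow_mul, mul_pow y Q]
    ring
  · simp [hQ1, hH1]
  · have h1 : H ∣ X ^ a * (Q ^ (2 ^ s - 1) * H) ^ 2 ^ v :=
      Dvd.dvd.mul_left (dvd_pow (Dvd.intro_left _ rfl) (by positivity)) _
    have h2 := mul_dvd_mul_left (X ^ (g * c) - 1 : (ZMod 2)[X]) h1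
    rw [hH, ← hQ] at h2
    exact (Dvd.intro _ rfl).trans h2

lemma main (n k : ℕ) (hn : 0 < n) (hk : 0 < k)
    (a : Fin k → ℕ) (ha : ∀ i, 0 < a i) (V : (ZMod 2)[X]) (hV : V.eval 1 = 1) :
    n ≤ (V * ∏ i, ∑ j ∈ Finset.Icc 1 n, (X : (ZMod 2)[X]) ^ (j * a i)).support.card := by
  obtain ⟨s, m, hm, hn2⟩ := Nat.exists_eq_two_pow_mul_odd hn.ne'
  choose v b hb hab using fun i => Nat.exists_eq_two_pow_mul_odd (ha i).ne'
  set g := Finset.univ.gcd b with hg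
  have hgb : ∀ i, g ∣ b i := fun i => Finset.gcd_dvd (Finset.mem_univ i)
  choose E hE1 hE2 hE3 using fun i => factor n s m (a i) (v i) (b i) g hn2 hm (hab i) (hb i) (hgb i)
  have i0 : Fin k := ⟨0, hk⟩
  have hgpos : 0 < g := Nat.pos_of_dvd_of_pos (hgb i0) (hb i0).pos
  have hmpos : 0 < m := hm.pos
  have hD : 0 < m * g := by positivity
  set R := V * ∏ i, E i with hR
  have hP : V * ∏ i, ∑ j ∈ Finset.Icc 1 n, (X : (ZMod 2)[X]) ^ (j * a i) =
      (X ^ (m * g) - 1) ^ ((2 ^ s - 1) * ∑ i, 2 ^ v i) * R := by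
    rw [Finset.prod_congr rfl fun i _ => hE1 i, Finset.prod_mul_distrib, Finset.prod_pow_eq_pow_sum,
      ← Finset.mul_sum, hR]
    ring
  have hR1 : R.eval 1 = 1 := by simp [hR, eval_prod, hE2, hV]
  have hper : ∀ i, Function.Periodic (fun r => fc (m * g) r R) (b i) := by
    intro i r
    have hd : (X ^ (m * g) - 1 : (ZMod 2)[X]) ∣ (X ^ b i - 1) * R := by
      have : (X ^ b i - 1) * E i ∣ (X ^ b i - 1) * R :=
        mul_dvd_mul_left _ ((Finset.dvd_prod_of_mem E (Finset.mem_univ i)).mul_left V)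
      exact (hE3 i).trans this
    obtain ⟨T, hT⟩ := hd
    have h0 := fc_mul_sub (m * g) (r + b i) T
    rw [← hT, sub_mul, one_mul, map_sub, fc_shift, sub_eq_zero] at h0
    exact h0.symm
  have hperg : Function.Periodic (fun r => fc (m * g) r R) g := by
    have : ∀ T : Finset (Fin k), Function.Periodic (fun r => fc (m * g) r R) (T.gcd b) := by
      intro T
      induction T using Finset.induction_on with
      | empty => intro r; simp
      | insert i T _ ih =>
        rw [Finset.gcd_insert]
        exact periodic_gcd _ _ _ (hper i) ih
    exact this _
  have hW : m ≤ W (m * g) R := by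
    have hWe : W (m * g) R = m * ((Finset.range g).filter fun r => fc (m * g) r R ≠ 0).card := by
      unfold W
      apply card_range_mul_periodic
      intro r
      have := hperg r
      simp only at this
      rw [this]
    have hWne : W (m * g) R ≠ 0 := by
      intro h0
      unfold W at h0
      rw [Finset.card_eq_zero, Finset.filter_eq_empty_iff] at h0
      have := sum_fc (m * g) hD R
      rw [Finset.sum_eq_zero (fun r hr => not_not.1 (h0 hr)), hR1] at this
      exact zero_ne_one this
    rw [hWe] at hWne ⊢
    exact Nat.le_mul_of_pos_right _ (Nat.pos_of_ne_zero (right_ne_zero_of_mul hWne))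
  rw [hP]
  refine le_trans ?_ (weight _ _ hD R)
  have hbc : 2 ^ s ≤ 2 ^ bc ((2 ^ s - 1) * ∑ i, 2 ^ v i) := by
    apply Nat.pow_le_pow_right (by norm_num)
    by_cases hs : s = 0
    · omega
    apply le_bc _ _ _ (Dvd.intro _ rfl)
    apply Nat.mul_pos
    · have : 1 < 2 ^ s := Nat.one_lt_two_pow hs
      omega
    · exact Finset.sum_pos (fun i _ => by positivity) ⟨i0, Finset.mem_univ _⟩
  calc n = 2 ^ s * m := hn2
    _ ≤ _ := Nat.mul_le_mul hbc hW

end PilzAux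

/-- Strengthened sumset variant of Pilz's conjecture: for any finite nonempty set `V`
of positive integers of odd cardinality, the set
`V ⊕ {a₁,2a₁,…,na₁} ⊕ ⋯ ⊕ {a_k,2a_k,…,na_k}` (elements represented an odd number
of times) has at least `n` elements. -/
theorem pilz_sumset_variant_with_odd_set (n k : ℕ) (hn : 0 < n) (hk : 0 < k)
    (a : Fin k → ℕ) (ha : ∀ i, 0 < a i)
    (V : Finset ℕ) (hVne : V.Nonempty) (hVpos : ∀ v ∈ V, 0 < v) (hVodd : Odd V.card) :
    n ≤ Set.ncard {m : ℕ |
      Odd (((V ×ˢ Fintype.piFinset fun _ : Fin k => Finset.Icc 1 n).filter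
        (fun p => p.1 + ∑ i, p.2 i * a i = m)).card)} := by
  classical
  have h := PilzAux.main n k hn hk a ha (∑ v ∈ V, X ^ v) (by
    simp only [eval_finset_sum, eval_pow, eval_X, one_pow, Finset.sum_const, nsmul_eq_mul, mul_one]
    exact ZMod.natCast_eq_one_iff_odd.2 hVodd)
  refine h.trans (le_of_eq ?_)
  rw [← Set.ncard_coe_finset]
  congr 1
  ext m
  rw [Finset.mem_coe, mem_support_iff, Set.mem_setOf_eq, ← ZMod.natCast_ne_zero_iff_odd]
  rw [Finset.prod_univ_sum, Finset.sum_mul_sum, ← Finset.sum_product']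
  simp only [Finset.prod_pow_eq_pow_sum, ← pow_add, finset_sum_coeff, coeff_X_pow]
  rw [Finset.sum_boole]
  simp only [eq_comm]
end

section
/- Let n and k be positive integers and a_1, ..., a_k positive integers. Then the polynomial ∏_{i=1}^k (x^{a_i} + x^{2a_i} + ... + x^{n·a_i}) over the field 𝔽₂ has at least n nonzero coefficients. -/
open Polynomial

namespace Pilz

noncomputable section

/-- binary digit sum -/
def pop (n : ℕ) : ℕ := (Nat.digits 2 n).sum

lemma pop_zero : pop 0 = 0 := by simp [pop]

lemma pop_even (n : ℕ) : pop (2 * n) = pop n := by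
  rcases Nat.eq_zero_or_pos n with rfl | h
  · simp
  · unfold pop
    rw [Nat.digits_def' (by norm_num) (by omega)]
    simp

lemma pop_odd (n : ℕ) : pop (2 * n + 1) = pop n + 1 := by
  unfold pop
  rw [Nat.digits_def' (by norm_num) (by omega)]
  have h1 : (2 * n + 1) % 2 = 1 := by omega
  have h2 : (2 * n + 1) / 2 = n := by omega
  rw [h1, h2]
  simp [add_comm]

lemma pop_succ_le (a : ℕ) : pop (a + 1) ≤ pop a + 1 := by
  induction a using Nat.strong_induction_on with
  | _ a ih =>
    rcases Nat.even_or_odd' a with ⟨k, rfl | rfl⟩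
    · rw [pop_odd, pop_even]
    · have := ih k (by omega)
      rw [show 2 * k + 1 + 1 = 2 * (k + 1) by ring, pop_even, pop_odd]
      omega

lemma pop_add_le (a b : ℕ) : pop (a + b) ≤ pop a + pop b := by
  induction a using Nat.strong_induction_on generalizing b with
  | _ a ih =>
    rcases Nat.eq_zero_or_pos a with rfl | ha
    · simp
    rcases Nat.even_or_odd' a with ⟨k, rfl | rfl⟩ <;>
      rcases Nat.even_or_odd' b with ⟨l, rfl | rfl⟩
    · have := ih k (by omega) l
      rw [← mul_add, pop_even, pop_even, pop_even]; omega
    · have := ih k (by omega) l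
      rw [← add_assoc, ← mul_add, pop_even, pop_odd, pop_odd]; omega
    · have := ih k (by omega) l
      rw [show 2 * k + 1 + 2 * l = 2 * (k + l) + 1 by ring, pop_even, pop_odd, pop_odd]; omega
    · have := ih k (by omega) l
      have h := pop_succ_le (k + l)
      rw [show 2 * k + 1 + (2 * l + 1) = 2 * (k + l + 1) by ring, pop_even, pop_odd, pop_odd]
      omega

lemma pop_split (s q r : ℕ) (hr : r < 2 ^ s) : pop (2 ^ s * q + r) = pop q + pop r := by
  induction s generalizing r with
  | zero =>
    have : r = 0 := by simpa using hr
    subst this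
    simp [pop_zero]
  | succ s ih =>
    rw [pow_succ] at *
    rcases Nat.even_or_odd' r with ⟨k, rfl | rfl⟩
    · rw [show 2 ^ s * 2 * q + 2 * k = 2 * (2 ^ s * q + k) by ring, pop_even, pop_even,
        ih k (by omega)]
    · rw [show 2 ^ s * 2 * q + (2 * k + 1) = 2 * (2 ^ s * q + k) + 1 by ring, pop_odd, pop_odd,
        ih k (by omega)]
      omega

lemma pop_pred (s : ℕ) : pop (2 ^ s - 1) = s := by
  induction s with
  | zero => simp [pop_zero]
  | succ s ih =>
    have := Nat.one_le_two_pow (n := s)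
    rw [show 2 ^ (s + 1) - 1 = 2 * (2 ^ s - 1) + 1 by rw [pow_succ]; omega, pop_odd, ih]

lemma le_pop (s N : ℕ) (hN : 0 < N) (hd : (2 ^ s - 1) ∣ N) : s ≤ pop N := by
  induction N using Nat.strong_induction_on with
  | _ N ih =>
    rcases Nat.eq_zero_or_pos s with rfl | hs
    · exact Nat.zero_le _
    have h2 : 2 ≤ 2 ^ s := by
      calc 2 = 2 ^ 1 := by norm_num
        _ ≤ 2 ^ s := Nat.pow_le_pow_right (by norm_num) hs
    rcases lt_or_ge N (2 ^ s) with h | h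
    · have : N = 2 ^ s - 1 := by
        have := Nat.le_of_dvd hN hd
        omega
      rw [this, pop_pred]
    · have hdm := Nat.div_add_mod N (2 ^ s)
      have hlt := Nat.mod_lt N (show 0 < 2 ^ s by omega)
      set q := N / 2 ^ s with hq
      set r := N % 2 ^ s with hrr
      have hq0 : 0 < q := Nat.div_pos h (by omega)
      have hqN : 2 * q ≤ 2 ^ s * q := Nat.mul_le_mul_right _ h2
      have e : N = (2 ^ s - 1) * q + (q + r) := by
        rw [← hdm]
        obtain ⟨t, ht⟩ := Nat.exists_eq_add_of_le (show 1 ≤ 2 ^ s by omega)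
        rw [ht, Nat.add_sub_cancel_left]; ring
      have hd' : (2 ^ s - 1) ∣ q + r := by
        rw [e] at hd
        exact (Nat.dvd_add_right (dvd_mul_right _ _)).1 hd
      have := ih (q + r) (by omega) (by omega) hd'
      have h3 := pop_add_le q r
      rw [← hdm, pop_split s q r hlt]
      omega

abbrev F := ZMod 2

/-- the `r`-th section of `P` modulo `m` -/
def sec (m r : ℕ) (P : F[X]) : F[X] := contract m (divX^[r] P)

lemma coeff_iter (r : ℕ) (P : F[X]) (j : ℕ) : (divX^[r] P).coeff j = P.coeff (j + r) := by
  induction r generalizing P with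
  | zero => simp
  | succ r ih => rw [Function.iterate_succ_apply, ih, coeff_divX]; congr 1

lemma coeff_sec {m : ℕ} (hm : m ≠ 0) (r : ℕ) (P : F[X]) (j : ℕ) :
    (sec m r P).coeff j = P.coeff (j * m + r) := by
  rw [sec, coeff_contract hm, coeff_iter]

lemma sec_add {m : ℕ} (hm : m ≠ 0) (r : ℕ) (P Q : F[X]) :
    sec m r (P + Q) = sec m r P + sec m r Q := by
  ext j; simp [coeff_sec hm]

lemma sec_sub {m : ℕ} (hm : m ≠ 0) (r : ℕ) (P Q : F[X]) :
    sec m r (P - Q) = sec m r P - sec m r Q := by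
  ext j; simp [coeff_sec hm]

lemma sec_expand_mul {m : ℕ} (hm : m ≠ 0) {r : ℕ} (hr : r < m) (A P : F[X]) :
    sec m r (expand F m A * P) = A * sec m r P := by
  induction A using Polynomial.induction_on' with
  | add A B hA hB => rw [map_add, add_mul, sec_add hm, hA, hB, add_mul]
  | monomial i c =>
    ext j
    rw [expand_monomial, coeff_sec hm, ← C_mul_X_pow_eq_monomial, ← C_mul_X_pow_eq_monomial,
      mul_assoc, mul_assoc, coeff_C_mul, coeff_C_mul, coeff_X_pow_mul', coeff_X_pow_mul']
    by_cases h : i ≤ j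
    · obtain ⟨t, rfl⟩ := Nat.exists_eq_add_of_le h
      rw [if_pos (by nlinarith), if_pos h, coeff_sec hm]
      congr 2
      rw [Nat.add_sub_cancel_left, add_mul, add_assoc, Nat.mul_comm i m]
      omega
    · rw [if_neg, if_neg h]
      have : (j + 1) * m ≤ i * m := Nat.mul_le_mul_right _ (by omega)
      nlinarith

lemma sec_succ_X_mul {m : ℕ} (hm : m ≠ 0) (r : ℕ) (P : F[X]) :
    sec m (r + 1) (X * P) = sec m r P := by
  ext j
  rw [coeff_sec hm, coeff_sec hm, ← add_assoc, coeff_X_mul]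

lemma sum_card_sec {m : ℕ} (hm : m ≠ 0) (P : F[X]) :
    ∑ r ∈ Finset.range m, (sec m r P).support.card ≤ P.support.card := by
  rw [← Finset.card_sigma]
  apply Finset.card_le_card_of_injOn (fun x => x.2 * m + x.1)
  · rintro ⟨r, j⟩ h
    simp only [Finset.coe_sigma, Set.mem_sigma_iff, Finset.mem_coe, Finset.mem_range,
      mem_support_iff, coeff_sec hm] at h ⊢
    exact h.2
  · rintro ⟨r, j⟩ h ⟨r', j'⟩ h' e
    simp only [Finset.coe_sigma, Set.mem_sigma_iff, Finset.mem_coe, Finset.mem_range] at h h' e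
    have e1 : r = r' := by
      have := congrArg (· % m) e
      simpa [Nat.add_mod, Nat.mod_eq_of_lt h.1, Nat.mod_eq_of_lt h'.1] using this
    subst e1
    have : j = j' := Nat.eq_of_mul_eq_mul_right (Nat.pos_of_ne_zero hm) (by omega)
    subst this
    rfl

lemma sum_sec {m : ℕ} (hm : m ≠ 0) (P : F[X]) :
    P = ∑ r ∈ Finset.range m, X ^ r * expand F m (sec m r P) := by
  ext d
  have hmod := Nat.mod_lt d (Nat.pos_of_ne_zero hm)
  rw [finsetSum_coeff, Finset.sum_eq_single (d % m)]
  · rw [coeff_X_pow_mul', if_pos (Nat.mod_le _ _), coeff_expand (Nat.pos_of_ne_zero hm),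
      if_pos (Nat.dvd_sub_mod d), coeff_sec hm, Nat.div_mul_cancel (Nat.dvd_sub_mod d),
      Nat.sub_add_cancel (Nat.mod_le _ _)]
  · intro r hr hne
    rw [coeff_X_pow_mul']
    split_ifs with h
    · rw [coeff_expand (Nat.pos_of_ne_zero hm), if_neg]
      intro hd
      apply hne
      have := (Nat.modEq_iff_dvd' h).2 hd
      unfold Nat.ModEq at this
      rw [Nat.mod_eq_of_lt (Finset.mem_range.1 hr)] at this
      exact this
    · rfl
  · intro h
    exact absurd (Finset.mem_range.2 hmod) h

lemma eval_sum_sec {m : ℕ} (hm : m ≠ 0) (P : F[X]) :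
    P.eval 1 = ∑ r ∈ Finset.range m, (sec m r P).eval 1 := by
  conv_lhs => rw [sum_sec hm P]
  simp [eval_finsetSum, expand_eval]

lemma sq_eq_expand : (X - 1 : F[X]) ^ 2 = expand F 2 (X - 1) := by
  have := sub_pow_char (R := F[X]) (p := 2) X 1
  simpa using this

lemma weight_lemma (N : ℕ) (Q : F[X]) (hQ : Q.eval 1 = 1) :
    2 ^ pop N ≤ ((X - 1) ^ N * Q).support.card := by
  induction N using Nat.strong_induction_on generalizing Q with
  | _ N ih =>
    rcases Nat.eq_zero_or_pos N with rfl | hN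
    · rw [pop_zero, pow_zero, pow_zero, one_mul, Nat.one_le_iff_ne_zero]
      intro h
      rw [Finset.card_eq_zero, support_eq_empty] at h
      simp [h] at hQ
    have he := eval_sum_sec two_ne_zero Q
    rw [hQ, Finset.sum_range_succ, Finset.sum_range_one] at he
    have hd2 : ∀ u v : F, 1 = u + v → v - u = 1 ∧ u - v = 1 := by decide
    rcases Nat.even_or_odd' N with ⟨k, rfl | rfl⟩
    · have hs := sum_card_sec two_ne_zero ((X - 1) ^ (2 * k) * Q)
      rw [pow_mul, sq_eq_expand, ← map_pow, Finset.sum_range_succ, Finset.sum_range_one,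
        sec_expand_mul two_ne_zero (by norm_num), sec_expand_mul two_ne_zero (by norm_num)] at hs
      rw [pop_even, pow_mul, sq_eq_expand, ← map_pow]
      have hor : ∀ u v : F, 1 = u + v → u = 1 ∨ v = 1 := by decide
      rcases hor _ _ he with h | h
      · have := ih k (by omega) _ h
        omega
      · have := ih k (by omega) _ h
        omega
    · have hs := sum_card_sec two_ne_zero ((X - 1) ^ (2 * k) * ((X - 1) * Q))
      have h0 : (sec 2 0 ((X - 1) * Q)).eval 1 = 1 := by
        have e1 : sec 2 0 (X * Q) = X * sec 2 1 Q := by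
          ext j
          rw [coeff_sec two_ne_zero]
          cases j with
          | zero => simp
          | succ j =>
            rw [show (j + 1) * 2 + 0 = (j * 2 + 1) + 1 by ring, coeff_X_mul, coeff_X_mul,
              coeff_sec two_ne_zero]
        rw [sub_mul, one_mul, sec_sub two_ne_zero, e1, eval_sub, eval_mul, eval_X, one_mul]
        exact (hd2 _ _ he).1
      have h1 : (sec 2 1 ((X - 1) * Q)).eval 1 = 1 := by
        rw [sub_mul, one_mul, sec_sub two_ne_zero, sec_succ_X_mul two_ne_zero, eval_sub]
        exact (hd2 _ _ he).2
      rw [pow_mul, sq_eq_expand, ← map_pow, Finset.sum_range_succ, Finset.sum_range_one,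
        sec_expand_mul two_ne_zero (by norm_num), sec_expand_mul two_ne_zero (by norm_num)] at hs
      rw [pop_odd, pow_succ, pow_succ (X - 1 : F[X]), mul_assoc, pow_mul, sq_eq_expand, ← map_pow]
      have g0 := ih k (by omega) _ h0
      have g1 := ih k (by omega) _ h1
      omega

lemma weight_main (m N s : ℕ) (hm : m ≠ 0) (hs : s ≤ pop N) (Q : F[X]) (hQ : Q.eval 1 = 1)
    (hdvd : (X ^ m - 1 : F[X]) ∣ (X - 1) * Q) :
    2 ^ s * m ≤ ((X ^ m - 1) ^ N * Q).support.card := by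
  have hx : (X ^ m - 1 : F[X]) = expand F m (X - 1) := by simp
  obtain ⟨T, hT⟩ := hdvd
  have hstep : ∀ r, r + 1 < m → (sec m (r + 1) Q).eval 1 = (sec m r Q).eval 1 := by
    intro r hr
    have h := congrArg (fun P => (sec m (r + 1) P).eval 1) hT
    rw [hx, sec_expand_mul hm hr, sub_mul, one_mul, sec_sub hm, sec_succ_X_mul hm, eval_sub] at h
    simp only [eval_mul, eval_sub, eval_X, eval_one, sub_self, zero_mul] at h
    exact (sub_eq_zero.1 h).symm
  have hall : ∀ r, r < m → (sec m r Q).eval 1 = (sec m 0 Q).eval 1 := by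
    intro r
    induction r with
    | zero => intro _; rfl
    | succ r ih => intro hr; rw [hstep r hr, ih (by omega)]
  have hc : (sec m 0 Q).eval 1 = 1 := by
    have h01 : ∀ u : F, u ≠ 0 → u = 1 := by decide
    apply h01
    intro h0
    have := eval_sum_sec hm Q
    rw [hQ, Finset.sum_eq_zero] at this
    · exact one_ne_zero this
    · intro r hr
      rw [hall r (Finset.mem_range.1 hr), h0]
  calc 2 ^ s * m = ∑ r ∈ Finset.range m, 2 ^ s := by simp [mul_comm]
    _ ≤ ∑ r ∈ Finset.range m, (sec m r ((X ^ m - 1) ^ N * Q)).support.card := by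
      apply Finset.sum_le_sum
      intro r hr
      rw [Finset.mem_range] at hr
      rw [hx, ← map_pow, sec_expand_mul hm hr]
      exact (Nat.pow_le_pow_right (by norm_num) hs).trans
        (weight_lemma N _ ((hall r hr).trans hc))
    _ ≤ _ := sum_card_sec hm _

lemma cast_odd {m : ℕ} (hm : Odd m) : (m : F) = 1 := by
  exact (ZMod.natCast_eq_one_iff_odd).2 hm

lemma factor (s m a : ℕ) (hm : Odd m) (ha : 0 < a) :
    ∃ (v : ℕ) (w : F[X]), ∑ j ∈ Finset.Icc 1 (2 ^ s * m), (X : F[X]) ^ (j * a) =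
      (X ^ m - 1) ^ (2 ^ v * (2 ^ s - 1)) * w ∧ w.eval 1 = 1 ∧
      (X ^ m - 1 : F[X]) ∣ (X ^ a - 1) * w := by
  obtain ⟨v, b, hb, rfl⟩ := Nat.exists_eq_two_pow_mul_odd (n := a) (by omega)
  set a := 2 ^ v * b with haa
  set wb : F[X] := ∑ i ∈ Finset.range b, (X ^ m) ^ i with hwb
  set g : F[X] := ∑ i ∈ Finset.range m, (X ^ a) ^ i with hg
  have e1 : ∑ j ∈ Finset.Icc 1 (2 ^ s * m), (X : F[X]) ^ (j * a) =
      X ^ a * ∑ i ∈ Finset.range (2 ^ s * m), (X ^ a) ^ i := by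
    rw [Finset.mul_sum, ← Finset.Ico_add_one_right_eq_Icc, Finset.sum_Ico_eq_sum_range]
    apply Finset.sum_congr (by simp)
    intro i _
    rw [← pow_mul, ← pow_add]; congr 1; ring
  have hne : (X ^ a - 1 : F[X]) ≠ 0 := X_pow_sub_C_ne_zero ha 1
  have e2 : ∑ i ∈ Finset.range (2 ^ s * m), ((X : F[X]) ^ a) ^ i
      = ((X ^ a) ^ m - 1) ^ (2 ^ s - 1) * g := by
    apply mul_right_cancel₀ hne
    have hp : 2 ^ s - 1 + 1 = 2 ^ s := Nat.sub_add_cancel Nat.one_le_two_pow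
    rw [geom_sum_mul, mul_assoc, hg, geom_sum_mul, ← pow_succ, hp, sub_pow_char_pow, one_pow,
      ← pow_mul _ m, mul_comm m]
  have e3 : ((X : F[X]) ^ a) ^ m - 1 = ((X ^ m - 1) * wb) ^ 2 ^ v := by
    rw [mul_comm, hwb, geom_sum_mul, sub_pow_char_pow, one_pow, ← pow_mul, ← pow_mul, ← pow_mul,
      haa]
    congr 2; ring
  refine ⟨v, X ^ a * wb ^ (2 ^ v * (2 ^ s - 1)) * g, ?_, ?_, ?_⟩
  · rw [e1, e2, e3, ← pow_mul, mul_pow]; ring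
  · simp [hwb, hg, eval_finsetSum, cast_odd hm, cast_odd hb]
  · have : (X ^ a - 1) * (X ^ a * wb ^ (2 ^ v * (2 ^ s - 1)) * g) =
        (g * (X ^ a - 1)) * (X ^ a * wb ^ (2 ^ v * (2 ^ s - 1))) := by ring
    rw [this, hg, geom_sum_mul, ← pow_mul, mul_comm a m, pow_mul]
    exact (sub_one_dvd_pow_sub_one _ _).mul_right _

lemma gcd_step (m : ℕ) (hm : m ≠ 0) (Q : F[X]) (i j : ℕ)
    (hi : (X ^ m - 1 : F[X]) ∣ (X ^ i - 1) * Q) (hj : (X ^ m - 1 : F[X]) ∣ (X ^ j - 1) * Q) :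
    (X ^ m - 1 : F[X]) ∣ (X ^ (Nat.gcd i j) - 1) * Q := by
  induction i, j using Nat.gcd.induction with
  | H0 n => simpa using hj
  | H1 i j hpos ih =>
    rw [Nat.gcd_rec]
    refine ih ?_ hi
    have h1 : (X ^ m - 1 : F[X]) ∣ (X ^ (i * (j / i)) - 1) * Q := by
      refine hi.trans (mul_dvd_mul_right ?_ Q)
      rw [pow_mul]
      exact sub_one_dvd_pow_sub_one _ _
    have h2 : (X ^ m - 1 : F[X]) ∣ X ^ (i * (j / i)) * ((X ^ (j % i) - 1) * Q) := by
      have := dvd_sub hj h1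
      convert this using 1
      have hX : (X : F[X]) ^ j = X ^ (i * (j / i)) * X ^ (j % i) := by
        rw [← pow_add, Nat.div_add_mod]
      rw [hX]
      ring
    refine IsCoprime.dvd_of_dvd_mul_left (IsCoprime.pow_right ?_) h2
    refine ⟨-1, X ^ (m - 1), ?_⟩
    rw [← pow_succ, Nat.sub_add_cancel (by omega)]
    ring

lemma coprime_case (s m k : ℕ) (hm : Odd m) (hk : 0 < k) (a : Fin k → ℕ) (ha : ∀ i, 0 < a i)
    (hgcd : Finset.univ.gcd a = 1) :
    2 ^ s * m ≤ (∏ i, ∑ j ∈ Finset.Icc 1 (2 ^ s * m), (X : F[X]) ^ (j * a i)).support.card := by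
  have hm0 : m ≠ 0 := by rintro rfl; simp at hm
  choose v w h1 h2 h3 using fun i => factor s m (a i) hm (ha i)
  have e : ∏ i, ∑ j ∈ Finset.Icc 1 (2 ^ s * m), (X : F[X]) ^ (j * a i) =
      (X ^ m - 1) ^ (∑ i, 2 ^ v i * (2 ^ s - 1)) * ∏ i, w i := by
    rw [Finset.prod_congr rfl (fun i _ => h1 i), Finset.prod_mul_distrib, Finset.prod_pow_eq_pow_sum]
  rw [e]
  apply weight_main m _ s hm0
  · rcases Nat.eq_zero_or_pos s with rfl | hs
    · exact Nat.zero_le _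
    apply le_pop
    · apply Finset.sum_pos
      · intro i _
        have : 1 < 2 ^ s := Nat.one_lt_two_pow (by omega)
        have : 0 < 2 ^ s - 1 := by omega
        positivity
      · exact ⟨⟨0, hk⟩, Finset.mem_univ _⟩
    · exact Finset.dvd_sum fun i _ => dvd_mul_left _ _
  · rw [eval_prod]; exact Finset.prod_eq_one fun i _ => h2 i
  · have key : ∀ S : Finset (Fin k), (X ^ m - 1 : F[X]) ∣ (X ^ (S.gcd a) - 1) * ∏ i, w i := by
      intro S
      induction S using Finset.induction_on with
      | empty => simp
      | insert i S _ ih =>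
        rw [Finset.gcd_insert]
        refine gcd_step m hm0 _ _ _ ?_ ih
        exact (h3 i).trans (mul_dvd_mul_left _ (Finset.dvd_prod_of_mem w (Finset.mem_univ i)))
    have := key Finset.univ
    rwa [hgcd, pow_one] at this

end

end Pilz

/-- The polynomial `∏_{i=1}^k (x^{aᵢ} + x^{2aᵢ} + ⋯ + x^{n·aᵢ})` over `𝔽₂`
has at least `n` nonzero coefficients. -/
theorem pilz_sumset_polynomial (n k : ℕ) (hn : 0 < n) (hk : 0 < k)
    (a : Fin k → ℕ) (ha : ∀ i, 0 < a i) :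
    n ≤ (∏ i, ∑ j ∈ Finset.Icc 1 n, (X : Polynomial (ZMod 2)) ^ (j * a i)).support.card := by
  obtain ⟨s, m, hm, rfl⟩ := Nat.exists_eq_two_pow_mul_odd (n := n) (by omega)
  obtain ⟨b, hb, hgb⟩ := Finset.extract_gcd a (s := Finset.univ) ⟨⟨0, hk⟩, Finset.mem_univ _⟩
  set g := Finset.univ.gcd a with hg
  have hab : ∀ i, a i = g * b i := fun i => hb i (Finset.mem_univ i)
  have hg0 : g ≠ 0 := by
    intro h
    have := ha ⟨0, hk⟩
    rw [hab, h] at this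
    simp at this
  have hbpos : ∀ i, 0 < b i := by
    intro i
    have := ha i
    rw [hab] at this
    exact Nat.pos_of_mul_pos_left this
  have h := Pilz.coprime_case s m k hm hk b hbpos hgb
  set P := ∏ i, ∑ j ∈ Finset.Icc 1 (2 ^ s * m), (X : Polynomial (ZMod 2)) ^ (j * b i) with hP
  have e : ∏ i, ∑ j ∈ Finset.Icc 1 (2 ^ s * m), (X : Polynomial (ZMod 2)) ^ (j * a i) =
      expand (ZMod 2) g P := by
    rw [hP, map_prod]
    refine Finset.prod_congr rfl fun i _ => ?_
    rw [map_sum]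
    refine Finset.sum_congr rfl fun j _ => ?_
    rw [map_pow, expand_X, ← pow_mul, hab]
    congr 1; ring
  rw [e]
  have hs : Pilz.sec g 0 (expand (ZMod 2) g P) = P := by
    simp [Pilz.sec, contract_expand _ hg0]
  refine h.trans (le_trans ?_ (Pilz.sum_card_sec hg0 _))
  have := Finset.single_le_sum (f := fun r => (Pilz.sec g r (expand (ZMod 2) g P)).support.card)
    (fun r _ => Nat.zero_le _) (Finset.mem_range.2 (Nat.pos_of_ne_zero hg0))
  simp only [hs] at this
  exact this
end

section
/- Let n and k be positive integers and a_1, ..., a_k positive integers. Then the polynomial ∏_{i=1}^k (1 + x^{a_i} + x^{2a_i} + ... + x^{(n-1)·a_i}) over the field 𝔽₂ has at least n nonzero coefficients. -/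
open Polynomial

/-- binary digit sum -/
def bitSum : ℕ → ℕ
  | 0 => 0
  | n + 1 => (n + 1) % 2 + bitSum ((n + 1) / 2)
decreasing_by omega

lemma bitSum_eq (n : ℕ) : bitSum n = n % 2 + bitSum (n / 2) := by
  cases n with
  | zero => simp [bitSum]
  | succ n => rw [bitSum]

lemma bitSum_add (a b : ℕ) : bitSum (a + b) ≤ bitSum a + bitSum b := by
  induction h : a + b using Nat.strong_induction_on generalizing a b with
  | _ N ih =>
    subst h
    rcases Nat.eq_zero_or_pos (a + b) with h0 | hpos
    · simp [h0, bitSum]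
    by_cases hc : a % 2 = 1 ∧ b % 2 = 1
    · have e0 := bitSum_eq (a + b)
      have e1 := bitSum_eq a
      have e2 := bitSum_eq b
      have h1 : (a + b) / 2 = a / 2 + (b / 2 + 1) := by omega
      by_cases hb : a / 2 + (b / 2 + 1) < a + b
      · have i1 := ih _ hb (a / 2) (b / 2 + 1) rfl
        have i2 := ih (b / 2 + 1) (by omega) (b / 2) 1 rfl
        have h1' : bitSum 1 = 1 := by simp [bitSum]
        rw [h1] at e0
        omega
      · omega
    · have e0 := bitSum_eq (a + b)
      have e1 := bitSum_eq a
      have e2 := bitSum_eq b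
      have h1 : (a + b) / 2 = a / 2 + b / 2 := by omega
      have i1 := ih (a / 2 + b / 2) (by omega) (a / 2) (b / 2) rfl
      rw [h1] at e0
      omega

lemma bitSum_mul_pow (m q t : ℕ) (ht : t < 2 ^ m) :
    bitSum (2 ^ m * q + t) = bitSum q + bitSum t := by
  induction m generalizing t with
  | zero =>
    have : t = 0 := by simpa using ht
    subst this
    simp [bitSum]
  | succ m ih =>
    have e0 := bitSum_eq (2 ^ (m + 1) * q + t)
    have e1 := bitSum_eq t
    have h2 : 2 ^ (m + 1) * q = 2 * (2 ^ m * q) := by ring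
    have h3 : 2 ^ (m + 1) = 2 * 2 ^ m := by ring
    rw [h2] at e0 ⊢
    have i1 := ih (t / 2) (by omega)
    have h4 : (2 * (2 ^ m * q) + t) / 2 = 2 ^ m * q + t / 2 := by omega
    rw [h4] at e0
    omega

lemma bitSum_pow_sub_one (m : ℕ) : bitSum (2 ^ m - 1) = m := by
  induction m with
  | zero => simp [bitSum]
  | succ m ih =>
    have h3 : 2 ^ (m + 1) = 2 * 2 ^ m := by ring
    have hp : 0 < 2 ^ m := by positivity
    rw [bitSum_eq]
    have h4 : (2 ^ (m + 1) - 1) / 2 = 2 ^ m - 1 := by omega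
    rw [h4, ih]
    omega

lemma le_bitSum_of_dvd (m N : ℕ) (hN : 0 < N) (hd : (2 ^ m - 1) ∣ N) : m ≤ bitSum N := by
  rcases Nat.eq_zero_or_pos m with rfl | hm
  · exact Nat.zero_le _
  induction N using Nat.strong_induction_on with
  | _ N ih =>
    have h2m : 2 ≤ 2 ^ m := by
      calc 2 = 2 ^ 1 := rfl
        _ ≤ 2 ^ m := Nat.pow_le_pow_right (by norm_num) hm
    have hdm := Nat.div_add_mod N (2 ^ m)
    have hlt := Nat.mod_lt N (show 0 < 2 ^ m by omega)
    set q := N / 2 ^ m with hq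
    set t := N % 2 ^ m with ht
    rcases Nat.eq_zero_or_pos q with h0 | hqp
    · rw [h0] at hdm
      have hle := Nat.le_of_dvd hN hd
      have : N = 2 ^ m - 1 := by
        simp only [mul_zero, zero_add] at hdm
        omega
      rw [this, bitSum_pow_sub_one]
    · have hb := bitSum_mul_pow m q t hlt
      rw [hdm] at hb
      have hadd := bitSum_add q t
      have hN2 : N = (2 ^ m - 1) * q + (q + t) := by
        rw [← hdm]
        obtain ⟨c, hc⟩ : ∃ c, 2 ^ m = c + 1 := ⟨2 ^ m - 1, by omega⟩
        rw [hc]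
        simp only [Nat.add_sub_cancel]
        ring
      have hd2 : (2 ^ m - 1) ∣ q + t := by
        rw [hN2] at hd
        exact (Nat.dvd_add_right (Dvd.intro _ rfl)).1 hd
      have hlt2 : q + t < N := by
        have : 0 < (2 ^ m - 1) * q := Nat.mul_pos (by omega) hqp
        omega
      have := ih (q + t) hlt2 (by omega) hd2
      omega

lemma card_support_split (r : ℕ) (hr : 0 < r) (B : ℕ → (ZMod 2)[X]) :
    ∑ i ∈ Finset.range r, (B i).support.card ≤
      (∑ i ∈ Finset.range r, X ^ i * expand (ZMod 2) r (B i)).support.card := by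
  have hcoeff : ∀ i < r, ∀ q, (∑ i ∈ Finset.range r, X ^ i * expand (ZMod 2) r (B i)).coeff
      (q * r + i) = (B i).coeff q := by
    intro i hi q
    rw [finsetSum_coeff, Finset.sum_eq_single i]
    · rw [coeff_X_pow_mul', if_pos (by omega), Nat.add_sub_cancel, coeff_expand_mul hr]
    · intro j hj hji
      rw [Finset.mem_range] at hj
      rw [coeff_X_pow_mul']
      split_ifs with h
      · rw [coeff_expand hr, if_neg]
        intro hd
        apply hji
        have h1 : j ≡ q * r + i [MOD r] := (Nat.modEq_iff_dvd' h).2 hd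
        have h2 : j % r = (q * r + i) % r := h1
        rw [Nat.mul_add_mod', Nat.mod_eq_of_lt hi, Nat.mod_eq_of_lt hj] at h2
        exact h2
      · rfl
    · intro h
      exact absurd (Finset.mem_range.2 hi) h
  rw [← Finset.card_sigma]
  apply Finset.card_le_card_of_injOn (fun p : (_ : ℕ) × ℕ => p.2 * r + p.1)
  · rintro ⟨i, q⟩ h
    simp only [Finset.coe_sigma, Set.mem_sigma_iff, Finset.mem_coe, Finset.mem_range,
      mem_support_iff] at h ⊢
    rw [hcoeff i h.1 q]
    exact h.2
  · rintro ⟨i, q⟩ h ⟨i', q'⟩ h' heq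
    simp only [Finset.coe_sigma, Set.mem_sigma_iff, Finset.mem_coe, Finset.mem_range] at h h' heq
    have e1 : i = i' := by
      have := congrArg (· % r) heq
      simpa [Nat.mul_add_mod', h.1, h'.1, Nat.mod_eq_of_lt] using this
    subst e1
    have e2 : q = q' := by
      have : q * r = q' * r := by omega
      exact Nat.eq_of_mul_eq_mul_right hr this
    subst e2
    rfl

lemma exists_split (g : (ZMod 2)[X]) :
    ∃ A B : (ZMod 2)[X], g = expand (ZMod 2) 2 A + X * expand (ZMod 2) 2 B := by
  induction g using Polynomial.induction_on' with
  | add p q hp hq =>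
    obtain ⟨A, B, h⟩ := hp
    obtain ⟨A', B', h'⟩ := hq
    refine ⟨A + A', B + B', ?_⟩
    rw [h, h', map_add, map_add]
    ring
  | monomial s c =>
    rcases Nat.even_or_odd' s with ⟨t, rfl | rfl⟩
    · refine ⟨monomial t c, 0, ?_⟩
      simp [expand_monomial, mul_comm]
    · refine ⟨0, monomial t c, ?_⟩
      simp [expand_monomial, X_mul_monomial, mul_comm]

lemma card_support_two (A B : (ZMod 2)[X]) : A.support.card + B.support.card ≤
    (expand (ZMod 2) 2 A + X * expand (ZMod 2) 2 B).support.card := by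
  have := card_support_split 2 (by norm_num) (fun i => if i = 0 then A else B)
  simpa [Finset.sum_range_succ] using this

lemma two_pow_bitSum_le (e : ℕ) (g : (ZMod 2)[X]) (hg : g.eval 1 ≠ 0) :
    2 ^ bitSum e ≤ ((X - 1) ^ e * g).support.card := by
  induction e using Nat.strong_induction_on generalizing g with
  | _ e ih =>
    rcases Nat.eq_zero_or_pos e with rfl | hpos
    · simp only [bitSum, pow_zero, one_mul]
      rw [Nat.one_le_iff_ne_zero, Finset.card_ne_zero, nonempty_support_iff]
      rintro rfl
      simp at hg
    obtain ⟨A, B, hAB⟩ := exists_split g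
    have hE : A.eval 1 + B.eval 1 ≠ 0 := by
      rw [hAB] at hg
      simpa [expand_eval] using hg
    have h2 : (2 : (ZMod 2)[X]) = 0 := CharTwo.two_eq_zero
    have key : ∀ t : ℕ, ((X - 1 : (ZMod 2)[X]) ^ (2 * t)) = expand (ZMod 2) 2 ((X - 1) ^ t) := by
      intro t
      rw [ZMod.expand_card, ← pow_mul, mul_comm]
    rcases Nat.even_or_odd' e with ⟨t, ht | ht⟩
    · have hb : bitSum e = bitSum t := by
        rw [bitSum_eq, ht]; simp
      have hf : (X - 1) ^ e * g = expand (ZMod 2) 2 ((X - 1) ^ t * A) +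
          X * expand (ZMod 2) 2 ((X - 1) ^ t * B) := by
        rw [ht, key, hAB, map_mul, map_mul]; ring
      rw [hf, hb]
      refine le_trans ?_ (card_support_two _ _)
      by_cases hA : A.eval 1 = 0
      · have hB : B.eval 1 ≠ 0 := by simpa [hA] using hE
        exact (ih t (by omega) B hB).trans (Nat.le_add_left _ _)
      · exact (ih t (by omega) A hA).trans (Nat.le_add_right _ _)
    · have hb : bitSum e = bitSum t + 1 := by
        rw [bitSum_eq, ht]
        have h5 : (2 * t + 1) / 2 = t := by omega
        have h6 : (2 * t + 1) % 2 = 1 := by omega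
        rw [h5, h6, add_comm]
      have hf : (X - 1) ^ e * g = expand (ZMod 2) 2 ((X - 1) ^ t * (A + X * B)) +
          X * expand (ZMod 2) 2 ((X - 1) ^ t * (A + B)) := by
        rw [ht, pow_succ, key, hAB]
        simp only [map_mul, map_add, expand_X]
        linear_combination (- expand (ZMod 2) 2 ((X - 1) ^ t) * (expand (ZMod 2) 2 A
          + X * expand (ZMod 2) 2 B)) * h2
      rw [hf, hb]
      refine le_trans ?_ (card_support_two _ _)
      have h7 := ih t (by omega) (A + X * B) (by simpa using hE)
      have h8 := ih t (by omega) (A + B) (by simpa using hE)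
      rw [pow_succ]
      omega

lemma geom_factor (m r a : ℕ) (ha : 0 < a) :
    ∑ j ∈ Finset.range (2 ^ m * r), (X : (ZMod 2)[X]) ^ (j * a) =
      expand (ZMod 2) r ((X ^ a - 1) ^ (2 ^ m - 1)) *
        ∑ j ∈ Finset.range r, (X : (ZMod 2)[X]) ^ (j * a) := by
  have hne : (X ^ a - 1 : (ZMod 2)[X]) ≠ 0 := by
    have := X_pow_sub_C_ne_zero ha (1 : ZMod 2)
    simpa using this
  have hs : ∀ N, (∑ j ∈ Finset.range N, (X : (ZMod 2)[X]) ^ (j * a)) * (X ^ a - 1)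
      = (X ^ a) ^ N - 1 := by
    intro N
    have h : ∀ j ∈ Finset.range N, (X : (ZMod 2)[X]) ^ (j * a) = (X ^ a) ^ j := by
      intro j _
      rw [← pow_mul, mul_comm]
    rw [Finset.sum_congr rfl h]
    exact geom_sum_mul _ _
  apply mul_right_cancel₀ hne
  rw [mul_assoc, hs, hs]
  have h1 : expand (ZMod 2) r ((X ^ a - 1) ^ (2 ^ m - 1)) =
      ((X ^ a) ^ r - 1 : (ZMod 2)[X]) ^ (2 ^ m - 1) := by
    simp only [map_pow, map_sub, expand_X, map_one]
    rw [← pow_mul, ← pow_mul, mul_comm]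
  rw [h1, ← pow_succ, Nat.sub_add_cancel Nat.one_le_two_pow, sub_pow_char_pow, one_pow,
    ← pow_mul, ← pow_mul, ← pow_mul]
  congr 2
  ring

lemma phi_surj (r k : ℕ) (a : Fin k → ℕ) (hgcd : Finset.univ.gcd a = 1)
    (φ : (Fin k → ZMod r) →+ ZMod r) (hφ : ∀ c, φ c = ∑ i, c i * (a i : ZMod r)) :
    Function.Surjective φ := by
  let S : AddSubgroup ℤ := (φ.range).comap (Int.castAddHom (ZMod r))
  obtain ⟨d, hd⟩ := Int.subgroup_cyclic S
  have hmem : ∀ i, (a i : ℤ) ∈ S := by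
    intro i
    show ((a i : ℤ) : ZMod r) ∈ φ.range
    refine ⟨Pi.single i 1, ?_⟩
    rw [hφ, Finset.sum_eq_single i]
    · simp
    · intro j _ hj
      simp [hj]
    · simp
  have hdvd : ∀ i, d ∣ (a i : ℤ) := by
    intro i
    have := hmem i
    rw [hd, AddSubgroup.mem_closure_singleton] at this
    obtain ⟨z, hz⟩ := this
    exact ⟨z, by rw [← hz]; simp [mul_comm]⟩
  have h1 : d.natAbs ∣ 1 := by
    rw [← hgcd]
    apply Finset.dvd_gcd
    intro i _
    exact Int.natAbs_dvd_natAbs.2 (hdvd i)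
  have h1S : ∀ z : ℤ, z ∈ S := by
    intro z
    rw [hd, AddSubgroup.mem_closure_singleton]
    have h2 : d ∣ z := (Int.natAbs_dvd.1 (by
      rw [Nat.dvd_one.1 h1]; simp))
    obtain ⟨w, hw⟩ := h2
    exact ⟨w, by rw [hw]; simp [mul_comm]⟩
  intro y
  obtain ⟨z, rfl⟩ := ZMod.intCast_surjective y
  exact h1S z

lemma odd_part_split (r k : ℕ) (hr : Odd r) (a : Fin k → ℕ) (hgcd : Finset.univ.gcd a = 1) :
    ∃ B : ℕ → (ZMod 2)[X], (∀ i < r, (B i).eval 1 ≠ 0) ∧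
      ∏ i, ∑ j ∈ Finset.range r, (X : (ZMod 2)[X]) ^ (j * a i) =
        ∑ i ∈ Finset.range r, X ^ i * expand (ZMod 2) r (B i) := by
  classical
  have hrpos : 0 < r := hr.pos
  have : NeZero r := ⟨hrpos.ne'⟩
  let φ : (Fin k → ZMod r) →+ ZMod r :=
    { toFun := fun c => ∑ i, c i * (a i : ZMod r)
      map_zero' := by simp
      map_add' := by intro x y; simp [add_mul, Finset.sum_add_distrib] }
  have hsurj := phi_surj r k a hgcd φ (fun _ => rfl)
  let w : (Fin k → ZMod r) → ℕ := fun c => ∑ i, (c i).val * a i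
  have hw : ∀ c, ((w c : ℕ) : ZMod r) = φ c := by
    intro c
    simp [w, φ]
  have hwmod : ∀ c, ∀ i < r, (w c % r = i ↔ φ c = (i : ZMod r)) := by
    intro c i hi
    rw [← hw, ZMod.natCast_eq_natCast_iff', Nat.mod_eq_of_lt hi]
  refine ⟨fun i => ∑ c with w c % r = i, X ^ (w c / r), ?_, ?_⟩
  · have hfib : ∀ i < r, ((Finset.univ.filter fun c => w c % r = i).card) =
        (Finset.univ.filter fun c => φ c = 0).card := by
      intro i hi
      have : (Finset.univ.filter fun c => w c % r = i) =
          (Finset.univ.filter fun c => φ c = (i : ZMod r)) := by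
        ext c
        simp [hwmod c i hi]
      rw [this]
      exact AddMonoidHom.card_fiber_eq_of_mem_range φ (hsurj _) (hsurj _)
    have htot : r * (Finset.univ.filter fun c => φ c = 0).card = r ^ k := by
      have h1 := Finset.card_eq_sum_card_fiberwise (s := (Finset.univ : Finset (Fin k → ZMod r)))
        (t := Finset.range r) (f := fun c => w c % r)
        (fun c _ => by simpa using Nat.mod_lt _ hrpos)
      rw [Finset.sum_congr rfl (fun i hi => hfib i (Finset.mem_range.1 hi))] at h1
      simp [ZMod.card] at h1
      simpa using h1.symm
    have hodd : Odd (Finset.univ.filter fun c => φ c = 0).card := by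
      have : Odd (r * (Finset.univ.filter fun c => φ c = 0).card) := by
        rw [htot]; exact hr.pow
      exact (Nat.odd_mul.1 this).2
    intro i hi
    rw [eval_finsetSum]
    simp only [eval_pow, eval_X, one_pow, Finset.sum_const, nsmul_eq_mul, mul_one]
    rw [hfib i hi]
    rw [Ne, ZMod.natCast_eq_zero_iff]
    exact hodd.not_two_dvd_nat
  · have hre : ∀ i, ∑ j ∈ Finset.range r, (X : (ZMod 2)[X]) ^ (j * a i) =
        ∑ z : ZMod r, (X : (ZMod 2)[X]) ^ (z.val * a i) := by
      intro i
      refine Finset.sum_bij' (fun j _ => (j : ZMod r)) (fun z _ => z.val) ?_ ?_ ?_ ?_ ?_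
      · intros; simp
      · intro z _; simpa using ZMod.val_lt z
      · intro j hj; exact ZMod.val_cast_of_lt (Finset.mem_range.1 hj)
      · intro z _; simp
      · intro j hj; rw [ZMod.val_cast_of_lt (Finset.mem_range.1 hj)]
    simp_rw [hre]
    rw [Finset.prod_univ_sum, Fintype.piFinset_univ]
    have h1 : ∀ c : Fin k → ZMod r, ∏ i, (X : (ZMod 2)[X]) ^ ((c i).val * a i) = X ^ (w c) := by
      intro c
      rw [Finset.prod_pow_eq_pow_sum]
    simp_rw [h1]
    rw [← Finset.sum_fiberwise_of_maps_to (t := Finset.range r) (g := fun c => w c % r)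
      (fun c _ => by simpa using Nat.mod_lt _ hrpos)]
    refine Finset.sum_congr rfl fun i _ => ?_
    rw [map_sum, Finset.mul_sum]
    refine Finset.sum_congr rfl fun c hc => ?_
    have hc' : w c % r = i := by simpa using hc
    rw [map_pow, expand_X, ← pow_mul, ← pow_add, ← hc', Nat.mod_add_div]

lemma main_gcd_one (n k : ℕ) (hn : 0 < n) (hk : 0 < k)
    (a : Fin k → ℕ) (ha : ∀ i, 0 < a i) (hgcd : Finset.univ.gcd a = 1) :
    n ≤ (∏ i, ∑ j ∈ Finset.range n, (X : (ZMod 2)[X]) ^ (j * a i)).support.card := by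
  obtain ⟨m, r, hr, rfl⟩ := Nat.exists_eq_two_pow_mul_odd hn.ne'
  obtain ⟨B, hB, hprod⟩ := odd_part_split r k hr a hgcd
  rw [Finset.prod_congr rfl (fun i _ => geom_factor m r (a i) (ha i)), Finset.prod_mul_distrib,
    hprod, ← map_prod, Finset.prod_pow]
  set Q : (ZMod 2)[X] := ∏ i, (X ^ a i - 1) with hQ
  have hQ0 : Q ≠ 0 := by
    rw [hQ, Finset.prod_ne_zero_iff]
    intro i _
    simpa using X_pow_sub_C_ne_zero (ha i) (1 : ZMod 2)
  have hQ1 : Q.IsRoot 1 := by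
    rw [IsRoot, hQ, eval_prod]
    exact Finset.prod_eq_zero (Finset.mem_univ (⟨0, hk⟩ : Fin k)) (by simp)
  obtain ⟨q, hq, hqd⟩ := exists_eq_pow_rootMultiplicity_mul_and_not_dvd Q hQ0 1
  have hS : 0 < rootMultiplicity 1 Q := (rootMultiplicity_pos hQ0).2 hQ1
  set S := rootMultiplicity 1 Q
  have hq1 : q.eval 1 ≠ 0 := fun h => hqd (dvd_iff_isRoot.2 h)
  have hbit : m ≤ bitSum (S * (2 ^ m - 1)) := by
    rcases Nat.eq_zero_or_pos m with rfl | hm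
    · exact Nat.zero_le _
    · refine le_bitSum_of_dvd m _ (Nat.mul_pos hS ?_) (Dvd.intro_left _ rfl)
      have := Nat.one_lt_two_pow hm.ne'
      omega
  have hterm : ∀ i < r, 2 ^ m ≤ (Q ^ (2 ^ m - 1) * B i).support.card := by
    intro i hi
    have h := two_pow_bitSum_le (S * (2 ^ m - 1)) (q ^ (2 ^ m - 1) * B i) (by
      rw [eval_mul, eval_pow]
      exact mul_ne_zero (pow_ne_zero _ hq1) (hB i hi))
    have he : Q ^ (2 ^ m - 1) * B i = (X - 1) ^ (S * (2 ^ m - 1)) * (q ^ (2 ^ m - 1) * B i) := by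
      conv_lhs => rw [hq]
      rw [C_1, mul_pow, ← pow_mul, mul_assoc]
    rw [he]
    exact (Nat.pow_le_pow_right (by norm_num) hbit).trans h
  have hfin : expand (ZMod 2) r (Q ^ (2 ^ m - 1)) *
      ∑ i ∈ Finset.range r, X ^ i * expand (ZMod 2) r (B i) =
      ∑ i ∈ Finset.range r, X ^ i * expand (ZMod 2) r (Q ^ (2 ^ m - 1) * B i) := by
    rw [Finset.mul_sum]
    refine Finset.sum_congr rfl fun i _ => ?_
    rw [map_mul]
    ring
  rw [hfin]
  refine le_trans ?_ (card_support_split r hr.pos _)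
  calc 2 ^ m * r = ∑ i ∈ Finset.range r, 2 ^ m := by simp [mul_comm]
    _ ≤ _ := Finset.sum_le_sum fun i hi => hterm i (Finset.mem_range.1 hi)

lemma card_support_expand_ge (g : ℕ) (hg : 0 < g) (f : (ZMod 2)[X]) :
    f.support.card ≤ (expand (ZMod 2) g f).support.card := by
  apply Finset.card_le_card_of_injOn (fun s => s * g)
  · intro s hs
    simp only [Finset.mem_coe, mem_support_iff] at hs ⊢
    rwa [coeff_expand_mul hg]
  · intro s _ t _ h
    exact Nat.eq_of_mul_eq_mul_right hg h

/-- The polynomial `∏_{i=1}^k (1 + x^{aᵢ} + x^{2aᵢ} + ⋯ + x^{(n-1)·aᵢ})` over `𝔽₂`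
has at least `n` nonzero coefficients. -/
theorem pilz_sumset_polynomial_shifted (n k : ℕ) (hn : 0 < n) (hk : 0 < k)
    (a : Fin k → ℕ) (ha : ∀ i, 0 < a i) :
    n ≤ (∏ i, ∑ j ∈ Finset.range n, (X : Polynomial (ZMod 2)) ^ (j * a i)).support.card := by
  obtain ⟨b, hb, hgcd⟩ := Finset.extract_gcd a (s := Finset.univ) ⟨⟨0, hk⟩, Finset.mem_univ _⟩
  set g := Finset.univ.gcd a
  have hb' : ∀ i, a i = g * b i := fun i => hb i (Finset.mem_univ i)
  have hbpos : ∀ i, 0 < b i := fun i => Nat.pos_of_ne_zero fun h => by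
    have := ha i
    rw [hb' i, h] at this
    simp at this
  have hgpos : 0 < g := Nat.pos_of_ne_zero fun h => by
    have := ha ⟨0, hk⟩
    rw [hb', h] at this
    simp at this
  have hexp : ∏ i, ∑ j ∈ Finset.range n, (X : Polynomial (ZMod 2)) ^ (j * a i) =
      expand (ZMod 2) g (∏ i, ∑ j ∈ Finset.range n, (X : Polynomial (ZMod 2)) ^ (j * b i)) := by
    simp only [map_prod, map_sum, map_pow, expand_X]
    refine Finset.prod_congr rfl fun i _ => Finset.sum_congr rfl fun j _ => ?_
    rw [← pow_mul, hb' i]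
    congr 1
    ring
  rw [hexp]
  exact (main_gcd_one n k hn hk b hbpos hgcd).trans (card_support_expand_ge g hgpos _)
end

section
/- Let n and k be positive integers, a_1, ..., a_k positive integers, and V a finite nonempty set of nonnegative integers of odd cardinality. Then the polynomial (∑_{v∈V} x^v) · ∏_{i=1}^k (x^{a_i} + x^{2a_i} + ... + x^{n·a_i}) over the field 𝔽₂ has at least n nonzero coefficients. -/
open Polynomial

namespace PilzAux

/-- Binary digit sum. -/
def s2 (n : ℕ) : ℕ := if h : n = 0 then 0 else n % 2 + s2 (n / 2)
decreasing_by omega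

theorem s2_zero : s2 0 = 0 := by rw [s2]; simp

theorem s2_even (u : ℕ) : s2 (2 * u) = s2 u := by
  by_cases h : u = 0
  · subst h; rfl
  · rw [s2, dif_neg (by omega)]
    have h1 : 2 * u % 2 = 0 := by omega
    have h2 : 2 * u / 2 = u := by omega
    rw [h1, h2, zero_add]

theorem s2_odd (u : ℕ) : s2 (2 * u + 1) = s2 u + 1 := by
  rw [s2, dif_neg (by omega)]
  have h1 : (2 * u + 1) % 2 = 1 := by omega
  have h2 : (2 * u + 1) / 2 = u := by omega
  rw [h1, h2, add_comm]

theorem s2_succ (n : ℕ) : s2 (n + 1) ≤ s2 n + 1 := by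
  induction n using Nat.strong_induction_on with
  | _ n ih =>
    rcases Nat.even_or_odd' n with ⟨u, rfl | rfl⟩
    · rw [s2_odd, s2_even]
    · have : 2 * u + 1 + 1 = 2 * (u + 1) := by ring
      rw [this, s2_even, s2_odd]
      have := ih u (by omega)
      omega

theorem s2_add (a : ℕ) : ∀ b, s2 (a + b) ≤ s2 a + s2 b := by
  induction a using Nat.strong_induction_on with
  | _ a ih =>
    intro b
    by_cases h0 : a = 0
    · subst h0; simp
    rcases Nat.even_or_odd' a with ⟨u, rfl | rfl⟩ <;>
    rcases Nat.even_or_odd' b with ⟨v, rfl | rfl⟩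
    · rw [← mul_add, s2_even, s2_even, s2_even]; exact ih u (by omega) v
    · rw [← add_assoc, ← mul_add, s2_even, s2_odd, s2_odd]
      have := ih u (by omega) v; omega
    · have : 2 * u + 1 + 2 * v = 2 * (u + v) + 1 := by ring
      rw [this, s2_even, s2_odd, s2_odd]
      have := ih u (by omega) v; omega
    · have : 2 * u + 1 + (2 * v + 1) = 2 * (u + v + 1) := by ring
      rw [this, s2_even, s2_odd, s2_odd]
      have := ih u (by omega) v
      have := s2_succ (u + v)
      omega

theorem s2_split (s : ℕ) : ∀ u r, r < 2 ^ s → s2 (2 ^ s * u + r) = s2 u + s2 r := by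
  induction s with
  | zero => intro u r hr; have : r = 0 := by simpa using hr
            subst this; simp [s2_zero]
  | succ s ih =>
    intro u r hr
    rw [pow_succ] at hr
    rcases Nat.even_or_odd' r with ⟨v, rfl | rfl⟩
    · have : 2 ^ (s + 1) * u + 2 * v = 2 * (2 ^ s * u + v) := by ring
      rw [this, s2_even, s2_even, ih u v (by omega)]
    · have : 2 ^ (s + 1) * u + (2 * v + 1) = 2 * (2 ^ s * u + v) + 1 := by ring
      rw [this, s2_odd, s2_odd, ih u v (by omega), add_assoc]

theorem s2_pred (s : ℕ) : s2 (2 ^ s - 1) = s := by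
  induction s with
  | zero => simp [s2_zero]
  | succ s ih =>
    have h : 0 < 2 ^ s := by positivity
    have : 2 ^ (s + 1) - 1 = 2 * (2 ^ s - 1) + 1 := by rw [pow_succ]; omega
    rw [this, s2_odd, ih]

theorem s2_mult (s T : ℕ) (hT : 0 < T) : s ≤ s2 ((2 ^ s - 1) * T) := by
  by_cases hs : s = 0
  · omega
  have h2 : 2 ≤ 2 ^ s := by
    calc 2 = 2 ^ 1 := rfl
      _ ≤ 2 ^ s := Nat.pow_le_pow_right (by norm_num) (by omega)
  obtain ⟨M, hM⟩ : ∃ M, 2 ^ s = M + 1 := ⟨2 ^ s - 1, by omega⟩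
  have hM' : 2 ^ s - 1 = M := by omega
  induction T using Nat.strong_induction_on with
  | _ T ih =>
    by_cases h1 : T = 1
    · subst h1; rw [mul_one, s2_pred]
    rw [hM'] at ih ⊢
    set t := M * T with ht
    set u := t / 2 ^ s with hu
    set r := t % 2 ^ s with hr
    have htur : 2 ^ s * u + r = t := Nat.div_add_mod _ _
    have hrlt : r < 2 ^ s := Nat.mod_lt _ (by omega)
    have hge : 2 * M ≤ t := by rw [ht, mul_comm]; exact Nat.mul_le_mul_left _ (by omega)
    have hupos : 0 < u := by
      rcases Nat.eq_zero_or_pos u with h | h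
      · rw [h] at htur; omega
      · exact h
    have hd : M * u + (u + r) = M * T := by rw [← ht, ← htur, hM]; ring
    have hle : u < T := by
      by_contra hc
      have : M * T ≤ M * u := Nat.mul_le_mul_left _ (by omega)
      omega
    have key : u + r = M * (T - u) := by
      rw [Nat.mul_sub]; omega
    rw [← htur, s2_split s u r hrlt]
    refine le_trans ?_ (s2_add u r)
    rw [key]
    exact ih (T - u) (by omega) (by omega)

abbrev R := Polynomial (ZMod 2)

noncomputable def Ps (m : ℕ) : R := ∑ i ∈ Finset.range m, X ^ i

theorem Ps_mul (m : ℕ) : Ps m * (X - 1) = X ^ m - 1 := geom_sum_mul _ _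

theorem contract_Ps {m : ℕ} (hm : m ≠ 0) : contract m (Ps m) = 1 := by
  ext j
  rw [coeff_contract hm, Ps, finsetSum_coeff]
  simp only [coeff_X_pow, Finset.sum_ite_eq, Finset.mem_range, coeff_one]
  congr 1
  rw [eq_iff_iff]
  constructor
  · intro h
    by_contra hc
    have : 1 * m ≤ j * m := Nat.mul_le_mul_right _ (by omega)
    omega
  · rintro rfl; omega

theorem expand_sub_one (m a : ℕ) : expand (ZMod 2) m (X ^ a - 1) = X ^ (m * a) - 1 := by
  simp [← pow_mul]

theorem eval_contract {m : ℕ} (hm : m ≠ 0) (h : R) :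
    eval 1 (contract m (Ps m * h)) = eval 1 h := by
  obtain ⟨g, hg⟩ : (X - C 1 : R) ∣ h - C (eval 1 h) := by
    rw [dvd_iff_isRoot]; simp
  have e : Ps m * h = Ps m * expand (ZMod 2) m (C (eval 1 h))
      + g * expand (ZMod 2) m (X ^ 1 - 1) := by
    rw [expand_sub_one, mul_one, ← Ps_mul, expand_C]
    rw [C_1] at hg
    linear_combination Ps m * hg
  rw [e, contract_add hm, contract_mul_expand hm, contract_mul_expand hm, contract_Ps hm]
  simp

theorem card_parts {m : ℕ} (hm : m ≠ 0) (p : R) :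
    ∑ e ∈ Finset.range m, (contract m (X ^ e * p)).support.card ≤ p.support.card := by
  rw [← Finset.card_sigma]
  have aux : ∀ x ∈ (Finset.range m).sigma (fun e => (contract m (X ^ e * p)).support),
      x.1 < m ∧ x.1 ≤ x.2 * m ∧ p.coeff (x.2 * m - x.1) ≠ 0 := by
    rintro ⟨e, j⟩ hx
    simp only [Finset.mem_sigma, Finset.mem_range, mem_support_iff, coeff_contract hm,
      coeff_X_pow_mul'] at hx
    obtain ⟨h1, h2⟩ := hx
    split_ifs at h2 with h
    · exact ⟨h1, h, h2⟩
    · exact absurd rfl h2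
  refine Finset.card_le_card_of_injOn (fun x => x.2 * m - x.1) ?_ ?_
  · intro x hx
    exact mem_support_iff.mpr (aux x hx).2.2
  · rintro ⟨e, j⟩ hx ⟨e', j'⟩ hx' heq
    obtain ⟨h1, h2, -⟩ := aux _ hx
    obtain ⟨h1', h2', -⟩ := aux _ hx'
    simp only at h1 h2 h1' h2' heq
    have hj : j = j' := by
      rcases lt_trichotomy j j' with h | h | h
      · have : (j + 1) * m ≤ j' * m := Nat.mul_le_mul_right _ h
        rw [add_mul] at this; omega
      · exact h
      · have : (j' + 1) * m ≤ j * m := Nat.mul_le_mul_right _ h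
        rw [add_mul] at this; omega
    subst hj
    have : e = e' := by omega
    subst this
    rfl

theorem contract_sum {m : ℕ} (hm : m ≠ 0) (p : R) :
    ∑ e ∈ Finset.range m, eval 1 (contract m (X ^ e * p)) = eval 1 p := by
  rw [← eval_contract hm p, Ps, Finset.sum_mul]
  rw [← eval_finsetSum]
  congr 1
  ext j
  simp [coeff_contract hm, finsetSum_coeff]

theorem exists_part {m : ℕ} (hm : m ≠ 0) (p : R) (hp : eval 1 p = 1) :
    ∃ e ∈ Finset.range m, eval 1 (contract m (X ^ e * p)) = 1 := by
  have h := contract_sum hm p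
  rw [hp] at h
  obtain ⟨e, he, h1⟩ := Finset.exists_ne_zero_of_sum_ne_zero (h.trans_ne one_ne_zero)
  exact ⟨e, he, Fin.eq_one_of_ne_zero _ h1⟩

theorem card_part_le {m e : ℕ} (hm : m ≠ 0) (he : e ∈ Finset.range m) (p : R) :
    (contract m (X ^ e * p)).support.card ≤ p.support.card :=
  (Finset.single_le_sum (f := fun e => (contract m (X ^ e * p)).support.card)
    (fun _ _ => Nat.zero_le _) he).trans (card_parts hm p)

theorem sub_pow_two (a s : ℕ) : (X ^ a - 1 : R) ^ 2 ^ s = X ^ (a * 2 ^ s) - 1 := by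
  rw [sub_pow_char_pow, one_pow, pow_mul]

theorem weight_s4 (t : ℕ) : ∀ Q : R, eval 1 Q = 1 →
    2 ^ s2 t ≤ ((X - 1) ^ t * Q).support.card := by
  induction t using Nat.strong_induction_on with
  | _ t ih =>
    intro Q hQ
    have hE : ∀ u, ((X - 1 : R) ^ (2 * u)) = expand (ZMod 2) 2 ((X - 1) ^ u) := by
      intro u
      rw [map_pow, pow_mul]
      congr 1
      have := sub_pow_two 1 1
      have h2 := expand_sub_one 2 1
      simp only [pow_one, one_mul, mul_one] at this h2
      rw [this, h2]
    by_cases h0 : t = 0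
    · subst h0
      rw [s2_zero, pow_zero, pow_zero, one_mul, Nat.one_le_iff_ne_zero, Finset.card_ne_zero,
        nonempty_support_iff]
      rintro rfl
      simp at hQ
    rcases Nat.even_or_odd' t with ⟨u, rfl | rfl⟩
    · obtain ⟨e, he, h1⟩ := exists_part two_ne_zero Q hQ
      refine le_trans ?_ (card_part_le two_ne_zero he _)
      rw [hE, mul_left_comm, mul_comm (expand (ZMod 2) 2 _), contract_mul_expand two_ne_zero, mul_comm (contract _ _), s2_even]
      exact ih u (by omega) _ h1
    · refine le_trans ?_ (card_parts two_ne_zero _)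
      have : ∀ e ∈ Finset.range 2, 2 ^ s2 u ≤
          (contract 2 (X ^ e * ((X - 1) ^ (2 * u + 1) * Q))).support.card := by
        intro e he
        have h1 : (X ^ e * ((X - 1) ^ (2 * u + 1) * Q) : R)
            = (Ps 2 * (X ^ e * Q)) * expand (ZMod 2) 2 ((X - 1) ^ u) := by
          rw [pow_succ, hE]
          have : Ps 2 = (X - 1 : R) := by
            rw [CharTwo.sub_eq_add]
            simp [Ps, Finset.sum_range_succ, add_comm]
          rw [this]; ring
        rw [h1, contract_mul_expand two_ne_zero, mul_comm]
        apply ih u (by omega)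
        rw [eval_contract two_ne_zero]
        simp [hQ]
      have h2 := Finset.card_nsmul_le_sum _ _ _ this
      rw [s2_odd, pow_succ]
      simpa [mul_comm] using h2

/-- `1 + x^a + ... + x^{(n-1)a}` -/
noncomputable def F (n a : ℕ) : R := ∑ j ∈ Finset.range n, (X ^ a) ^ j

theorem F_mul (n a : ℕ) : F n a * (X ^ a - 1) = X ^ (a * n) - 1 := by
  rw [pow_mul]; exact geom_sum_mul _ _

theorem eval_F (n a : ℕ) : eval 1 (F n a) = n := by
  simp [F, eval_finsetSum]

theorem odd_cast {m : ℕ} (h : Odd m) : (m : ZMod 2) = 1 := ZMod.natCast_eq_one_iff_odd.mpr h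

theorem sub_ne {a : ℕ} (ha : 0 < a) : (X ^ a - 1 : R) ≠ 0 := by
  have := X_pow_sub_C_ne_zero (R := ZMod 2) ha 1
  simpa using this

theorem F_factor (s m a : ℕ) (ha : 0 < a) :
    F (2 ^ s * m) a = (X ^ (m * a) - 1) ^ (2 ^ s - 1) * F m a := by
  apply mul_right_cancel₀ (sub_ne ha)
  rw [F_mul, mul_assoc, F_mul, mul_comm a m, ← pow_succ,
    Nat.sub_add_cancel Nat.one_le_two_pow, sub_pow_two]
  congr 2; ring

theorem sub_factor (m a : ℕ) (ha : 0 < a) : ∃ q : ℕ, 0 < q ∧ ∃ H : R, eval 1 H = 1 ∧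
    X ^ (m * a) - 1 = (X ^ m - 1) ^ q * H := by
  obtain ⟨v, b, hb, rfl⟩ := Nat.exists_eq_two_pow_mul_odd ha.ne'
  refine ⟨2 ^ v, by positivity, F b m ^ 2 ^ v, ?_, ?_⟩
  · rw [eval_pow, eval_F, odd_cast hb, one_pow]
  · rw [← mul_pow, mul_comm (X ^ m - 1 : R), F_mul, sub_pow_two]
    congr 2; ring

theorem gcd_step (D W : R) (i j : ℕ) : D ∣ W * (X ^ i - 1) → D ∣ W * (X ^ j - 1) →
    D ∣ W * (X ^ (Nat.gcd i j) - 1) := by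
  induction i, j using Nat.gcd.induction with
  | H0 n => intro _ h; simpa using h
  | H1 i j hi ih =>
    intro h1 h2
    rw [Nat.gcd_rec]
    refine ih ?_ h1
    have e : (W * (X ^ (j % i) - 1) : R) = W * (X ^ j - 1)
        - X ^ (j % i) * F (j / i) i * (W * (X ^ i - 1)) := by
      have h3 := F_mul (j / i) i
      have h4 : (X ^ j : R) = X ^ (j % i) * X ^ (i * (j / i)) := by
        rw [← pow_add, Nat.mod_add_div]
      rw [h4]
      linear_combination W * X ^ (j % i) * h3
    rw [e]
    exact dvd_sub h2 (h1.mul_left _)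

theorem gcd_all {ι : Type*} (D W : R) (S : Finset ι) (a : ι → ℕ)
    (h : ∀ i ∈ S, D ∣ W * (X ^ a i - 1)) : D ∣ W * (X ^ (S.gcd a) - 1) := by
  classical
  induction S using Finset.induction_on with
  | empty => simp
  | insert i S hi ih =>
    rw [Finset.gcd_insert]
    exact gcd_step D W _ _ (h i (Finset.mem_insert_self _ _))
      (ih fun j hj => h j (Finset.mem_insert_of_mem hj))

theorem Ps_dvd {ι : Type*} (m : ℕ) (hm : Odd m) (S : Finset ι) (a : ι → ℕ)
    (hg : S.gcd a = 1) : Ps m ∣ ∏ i ∈ S, F m (a i) := by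
  have h := gcd_all (Ps m) (∏ i ∈ S, F m (a i)) S a ?_
  · rw [hg, pow_one] at h
    refine IsCoprime.dvd_of_dvd_mul_right ?_ h
    have hirr : Irreducible (X - C 1 : R) := irreducible_X_sub_C 1
    rw [C_1] at hirr
    refine ((hirr.coprime_iff_not_dvd).2 ?_).symm
    intro hd
    rw [← C_1, dvd_iff_isRoot] at hd
    simp [Ps, IsRoot, eval_finsetSum, odd_cast hm] at hd
  · intro i hi
    have h0 : F m (a i) ∣ ∏ i ∈ S, F m (a i) :=
      Finset.dvd_prod_of_mem (fun i => F m (a i)) hi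
    have h1 : F m (a i) * (X ^ a i - 1) ∣ (∏ i ∈ S, F m (a i)) * (X ^ a i - 1) :=
      mul_dvd_mul_right h0 _
    refine dvd_trans ?_ h1
    have h2 : Ps m ∣ X ^ m - 1 := ⟨X - 1, (Ps_mul m).symm⟩
    have h3 : (X ^ m - 1 : R) ∣ (X ^ m) ^ a i - 1 ^ a i := sub_dvd_pow_sub_pow (X ^ m : R) 1 (a i)
    rw [one_pow, ← pow_mul, mul_comm m (a i)] at h3
    rw [F_mul]
    exact h2.trans h3

theorem core {ι : Type*} (n : ℕ) (hn : 0 < n) (S : Finset ι) (hS : S.Nonempty) (a : ι → ℕ)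
    (ha : ∀ i ∈ S, 0 < a i) (hg : S.gcd a = 1) (V : R) (hV : eval 1 V = 1) :
    n ≤ (V * ∏ i ∈ S, F n (a i)).support.card := by
  obtain ⟨s, m, hm, rfl⟩ := Nat.exists_eq_two_pow_mul_odd hn.ne'
  have hm0 : m ≠ 0 := by rintro rfl; simp at hm
  have hq : ∀ i : ι, ∃ q : ℕ, ∃ H : R, i ∈ S → 0 < q ∧ eval 1 H = 1 ∧
      X ^ (m * a i) - 1 = (X ^ m - 1) ^ q * H := by
    intro i
    by_cases hi : i ∈ S
    · obtain ⟨q, h1, H, h2, h3⟩ := sub_factor m (a i) (ha i hi)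
      exact ⟨q, H, fun _ => ⟨h1, h2, h3⟩⟩
    · exact ⟨0, 0, fun h => absurd h hi⟩
  choose q H hqH using hq
  obtain ⟨Z, hZ⟩ := Ps_dvd m hm S a hg
  have hZ1 : eval 1 Z = 1 := by
    have := congrArg (eval 1) hZ
    rw [eval_prod, eval_mul] at this
    simpa [eval_F, odd_cast hm, Ps, eval_finsetSum] using this.symm
  set T := ∑ i ∈ S, q i with hT
  have hTpos : 0 < T := Finset.sum_pos (fun i hi => (hqH i hi).1) hS
  set t := (2 ^ s - 1) * T with ht
  set K : R := V * (∏ i ∈ S, H i) ^ (2 ^ s - 1) * Z with hK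
  have hK1 : eval 1 K = 1 := by
    rw [hK, eval_mul, eval_mul, eval_pow, eval_prod, hV, hZ1,
      Finset.prod_eq_one (fun i hi => (hqH i hi).2.1)]
    simp
  have hP : V * ∏ i ∈ S, F (2 ^ s * m) (a i) = (X ^ m - 1) ^ t * (Ps m * K) := by
    have : ∏ i ∈ S, F (2 ^ s * m) (a i) =
        ∏ i ∈ S, (((X ^ m - 1) ^ q i * H i) ^ (2 ^ s - 1) * F m (a i)) :=
      Finset.prod_congr rfl fun i hi => by
        rw [F_factor s m _ (ha i hi), (hqH i hi).2.2]
    rw [this, Finset.prod_mul_distrib, Finset.prod_pow, Finset.prod_mul_distrib,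
      Finset.prod_pow_eq_pow_sum, hZ, ht, mul_comm (2 ^ s - 1) T, pow_mul, hK]
    ring
  rw [hP]
  refine le_trans ?_ (card_parts hm0 _)
  have : ∀ e ∈ Finset.range m, 2 ^ s ≤
      (contract m (X ^ e * ((X ^ m - 1) ^ t * (Ps m * K)))).support.card := by
    intro e he
    have h1 : (X ^ e * ((X ^ m - 1) ^ t * (Ps m * K)) : R)
        = (Ps m * (X ^ e * K)) * expand (ZMod 2) m ((X - 1) ^ t) := by
      have := expand_sub_one m 1
      rw [pow_one, mul_one] at this
      rw [map_pow, this]; ring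
    rw [h1, contract_mul_expand hm0, mul_comm]
    refine le_trans (Nat.pow_le_pow_right two_pos (s2_mult s T hTpos)) (weight_s4 t _ ?_)
    rw [eval_contract hm0]
    simp [hK1]
  have h2 := Finset.card_nsmul_le_sum _ _ _ this
  simpa [mul_comm] using h2

theorem core' {ι : Type*} (n : ℕ) (hn : 0 < n) (S : Finset ι) (hS : S.Nonempty) (a : ι → ℕ)
    (ha : ∀ i ∈ S, 0 < a i) (V : R) (hV : eval 1 V = 1) :
    n ≤ (V * ∏ i ∈ S, F n (a i)).support.card := by
  obtain ⟨i0, hi0⟩ := hS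
  obtain ⟨b, hb, hgb⟩ := Finset.extract_gcd a ⟨i0, hi0⟩
  set g := S.gcd a with hgdef
  have hg0 : g ≠ 0 := by
    intro h
    have := ha i0 hi0
    rw [hb i0 hi0, h] at this
    simp at this
  have hF : ∏ i ∈ S, F n (a i) = expand (ZMod 2) g (∏ i ∈ S, F n (b i)) := by
    rw [map_prod]
    refine Finset.prod_congr rfl fun i hi => ?_
    rw [hb i hi]
    simp [F, pow_mul]
  obtain ⟨e, he, h1⟩ := exists_part hg0 V hV
  refine le_trans ?_ (card_part_le hg0 he _)
  rw [hF, ← mul_assoc, contract_mul_expand hg0]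
  refine core n hn S ⟨i0, hi0⟩ b (fun i hi => ?_) hgb _ h1
  have := ha i hi
  rw [hb i hi] at this
  exact Nat.pos_of_mul_pos_left this

end PilzAux

/-- For a finite nonempty set `V` of nonnegative integers of odd cardinality, the polynomial
`(∑_{v∈V} x^v) · ∏_{i=1}^k (x^{aᵢ} + x^{2aᵢ} + ⋯ + x^{n·aᵢ})` over `𝔽₂`
has at least `n` nonzero coefficients. -/
theorem pilz_sumset_polynomial_with_odd_set (n k : ℕ) (hn : 0 < n) (hk : 0 < k)
    (a : Fin k → ℕ) (ha : ∀ i, 0 < a i)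
    (V : Finset ℕ) (hVne : V.Nonempty) (hVodd : Odd V.card) :
    n ≤ ((∑ v ∈ V, (X : Polynomial (ZMod 2)) ^ v) *
      ∏ i, ∑ j ∈ Finset.Icc 1 n, (X : Polynomial (ZMod 2)) ^ (j * a i)).support.card := by
  have h1 : ∀ i, ∑ j ∈ Finset.Icc 1 n, (X : Polynomial (ZMod 2)) ^ (j * a i)
      = X ^ a i * PilzAux.F n (a i) := by
    intro i
    rw [PilzAux.F, Finset.mul_sum, Finset.range_eq_Ico, ← Finset.Ico_add_one_right_eq_Icc,
      Finset.sum_Ico_eq_sum_range, Finset.range_eq_Ico]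
    refine Finset.sum_congr (by simp) fun j _ => ?_
    rw [← pow_mul, ← pow_add]
    congr 1; ring
  simp_rw [h1]
  rw [Finset.prod_mul_distrib, ← mul_assoc]
  refine PilzAux.core' n hn Finset.univ ⟨⟨0, hk⟩, Finset.mem_univ _⟩ a (fun i _ => ha i) _ ?_
  simp [eval_finsetSum, eval_prod, PilzAux.odd_cast hVodd]
end

section
/- Let t be an odd positive integer, k a positive integer, and a_1, ..., a_k positive integers with gcd(a_1, ..., a_k) = 1. Let q(x) = ∏_{i=1}^k (1 + x^{a_i} + x^{2a_i} + ... + x^{(t−1)·a_i}) in 𝔽₂[x]. Then for every residue class b modulo t, the number of exponents e with nonzero coefficient of x^e in q and e ≡ b (mod t) is odd. -/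
open Polynomial

theorem aux_bezout (k : ℕ) (a : Fin k → ℕ) (hgcd : Finset.univ.gcd a = 1) :
    ∃ f : Fin k → ℤ, ∑ i, f i * (a i : ℤ) = 1 := by
  obtain ⟨f, hf⟩ := Finset.gcd_eq_sum_mul Finset.univ (fun i => (a i : ℤ))
  have h1 : Finset.univ.gcd (fun i => (a i : ℤ)) = 1 := by
    have hd : (Finset.univ.gcd (fun i => (a i : ℤ))).natAbs ∣ Finset.univ.gcd a := by
      apply Finset.dvd_gcd
      intro i hi
      have := Finset.gcd_dvd (f := fun i => (a i : ℤ)) hi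
      exact Int.natAbs_dvd_natAbs.mpr this
    rw [hgcd, Nat.dvd_one] at hd
    have hu : IsUnit (Finset.univ.gcd (fun i => (a i : ℤ))) := Int.isUnit_iff_natAbs_eq.mpr hd
    rw [← Finset.normalize_gcd]
    exact normalize_eq_one.mpr hu
  refine ⟨f, ?_⟩
  rw [← h1, hf]
  exact Finset.sum_congr rfl fun i _ => mul_comm _ _

theorem aux_count (t k : ℕ) [NeZero t] (htodd : Odd t)
    (a : Fin k → ℕ) (hgcd : Finset.univ.gcd a = 1) (b : ZMod t) :
    Odd (Finset.univ.filter
      (fun v : Fin k → ZMod t => ∑ i, v i * (a i : ZMod t) = b)).card := by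
  classical
  let φ : (Fin k → ZMod t) →+ ZMod t :=
    { toFun := fun v => ∑ i, v i * (a i : ZMod t)
      map_zero' := by simp
      map_add' := fun v w => by simp [add_mul, Finset.sum_add_distrib] }
  have hsurj : Function.Surjective φ := by
    intro c
    obtain ⟨f, hf⟩ := aux_bezout k a hgcd
    refine ⟨fun i => c * (f i : ZMod t), ?_⟩
    have h2 : (∑ i, (f i : ZMod t) * (a i : ZMod t)) = 1 := by
      have := congrArg (Int.cast : ℤ → ZMod t) hf
      push_cast at this
      exact this
    change ∑ i, c * (f i : ZMod t) * (a i : ZMod t) = c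
    simp_rw [mul_assoc]
    rw [← Finset.mul_sum, h2, mul_one]
  have hfib : ∀ c : ZMod t, (Finset.univ.filter (fun v => φ v = c)).card
      = (Finset.univ.filter (fun v => φ v = b)).card := fun c =>
    AddMonoidHom.card_fiber_eq_of_mem_range φ (hsurj c) (hsurj b)
  have htot : (Finset.univ : Finset (Fin k → ZMod t)).card
      = ∑ c : ZMod t, (Finset.univ.filter (fun v => φ v = c)).card :=
    Finset.card_eq_sum_card_fiberwise (fun _ _ => Finset.mem_univ _)
  simp only [hfib, Finset.sum_const, smul_eq_mul] at htot
  have hc : (Finset.univ : Finset (Fin k → ZMod t)).card = t ^ k := by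
    simp [ZMod.card]
  rw [hc] at htot
  have hodd : Odd (t ^ k) := htodd.pow
  rw [htot] at hodd
  exact (Nat.odd_mul.mp hodd).2

/-- Let `t` be odd, `gcd(a₁,…,a_k) = 1` and
`q(x) = ∏_{i=1}^k (1 + x^{aᵢ} + ⋯ + x^{(t−1)aᵢ})` over `𝔽₂`. Then in every residue
class `b` modulo `t`, the number of exponents in the support of `q` is odd. -/
theorem support_odd_in_each_residue_class (t k : ℕ) (ht : 0 < t) (htodd : Odd t) (hk : 0 < k)
    (a : Fin k → ℕ) (ha : ∀ i, 0 < a i) (hgcd : Finset.univ.gcd a = 1)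
    (b : ZMod t) :
    Odd (((∏ i, ∑ j ∈ Finset.range t,
        (X : Polynomial (ZMod 2)) ^ (j * a i)).support.filter
      (fun e => ((e : ℕ) : ZMod t) = b)).card) := by
  classical
  have : NeZero t := ⟨ht.ne'⟩
  have hr : ∀ i, ∑ j ∈ Finset.range t, (X : Polynomial (ZMod 2)) ^ (j * a i)
      = ∑ j : ZMod t, (X : Polynomial (ZMod 2)) ^ (j.val * a i) := by
    intro i
    symm
    refine Finset.sum_bij (fun j _ => j.val) ?_ ?_ ?_ ?_
    · intro j _
      exact Finset.mem_range.mpr (ZMod.val_lt j)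
    · intro x _ y _ h
      exact ZMod.val_injective t h
    · intro j hj
      exact ⟨(j : ZMod t), Finset.mem_univ _,
        ZMod.val_cast_of_lt (Finset.mem_range.mp hj)⟩
    · intro j _
      rfl
  let L : Polynomial (ZMod 2) →ₗ[ZMod 2] ZMod 2 :=
    Polynomial.lsum (fun e => if ((e : ℕ) : ZMod t) = b then LinearMap.id else 0)
  have hL : ∀ p : Polynomial (ZMod 2), L p
      = ((p.support.filter (fun e => ((e : ℕ) : ZMod t) = b)).card : ZMod 2) := by
    intro p
    change p.sum _ = _
    rw [Polynomial.sum_def, Finset.card_filter, Nat.cast_sum]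
    refine Finset.sum_congr rfl fun e he => ?_
    have h1 : p.coeff e = 1 := by
      have h0 := Polynomial.mem_support_iff.mp he
      generalize p.coeff e = c at h0
      revert c
      decide
    by_cases h : ((e : ℕ) : ZMod t) = b <;> simp only [h, if_true, if_false, h1] <;> simp
  have hX : ∀ n : ℕ, L (X ^ n) = if ((n : ℕ) : ZMod t) = b then 1 else 0 := by
    intro n
    rw [hL, Polynomial.support_X_pow, Finset.filter_singleton]
    split_ifs <;> simp
  rw [← ZMod.natCast_eq_one_iff_odd, ← hL]
  simp_rw [hr]
  rw [Fintype.prod_sum, map_sum]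
  simp_rw [Finset.prod_pow_eq_pow_sum, hX]
  push_cast
  simp_rw [ZMod.natCast_zmod_val]
  rw [← Nat.cast_one, ← Nat.cast_zero]
  have := aux_count t k htodd a hgcd b
  rw [← ZMod.natCast_eq_one_iff_odd, Finset.card_filter] at this
  push_cast at this ⊢
  exact this
end

section
/- Let α be a positive integer and let m be a positive integer divisible by 2^α − 1. Then the number of ones in the binary representation of m (i.e., the binary digit sum of m) is at least α. -/
lemma bds_rec (n : ℕ) : (Nat.digits 2 n).sum = n % 2 + (Nat.digits 2 (n / 2)).sum := by
  rcases Nat.eq_zero_or_pos n with rfl | h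
  · simp
  · rw [Nat.digits_def' (by norm_num) h]; simp

lemma bds_add (N : ℕ) : ∀ a b c : ℕ, a + b ≤ N → c ≤ 1 →
    (Nat.digits 2 (a + b + c)).sum ≤ (Nat.digits 2 a).sum + (Nat.digits 2 b).sum + c := by
  induction N with
  | zero =>
    intro a b c h hc
    obtain rfl : a = 0 := by omega
    obtain rfl : b = 0 := by omega
    interval_cases c <;> simp
  | succ N ih =>
    intro a b c h hc
    by_cases h0 : a + b ≤ N
    · exact ih a b c h0 hc
    rw [bds_rec (a + b + c), bds_rec a, bds_rec b]
    have e : (a + b + c) / 2 = a / 2 + b / 2 + (a % 2 + b % 2 + c) / 2 := by omega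
    have := ih (a / 2) (b / 2) ((a % 2 + b % 2 + c) / 2) (by omega) (by omega)
    rw [e]
    omega

lemma bds_split (k : ℕ) : ∀ q r : ℕ, r < 2 ^ k →
    (Nat.digits 2 (2 ^ k * q + r)).sum = (Nat.digits 2 q).sum + (Nat.digits 2 r).sum := by
  induction k with
  | zero =>
    intro q r h
    obtain rfl : r = 0 := by simpa using h
    simp
  | succ k ih =>
    intro q r h
    rw [pow_succ] at h
    have e : 2 ^ (k + 1) * q + r = 2 * (2 ^ k * q) + r := by ring
    have := ih q (r / 2) (by omega)
    rw [bds_rec, bds_rec r, e]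
    have e1 : (2 * (2 ^ k * q) + r) / 2 = 2 ^ k * q + r / 2 := by omega
    rw [e1, this]
    omega

lemma bds_ones (k : ℕ) : (Nat.digits 2 (2 ^ k - 1)).sum = k := by
  induction k with
  | zero => simp
  | succ k ih =>
    have := Nat.one_le_two_pow (n := k)
    rw [bds_rec, pow_succ]
    have e1 : (2 ^ k * 2 - 1) / 2 = 2 ^ k - 1 := by omega
    rw [e1, ih]
    omega

/-- If `m` is a positive multiple of `2^α − 1` (with `α ≥ 1`), then the binary digit
sum (number of ones in binary) of `m` is at least `α`. -/
theorem binary_digit_sum_of_multiple (α m : ℕ) (hα : 0 < α) (hm : 0 < m)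
    (hdvd : (2 ^ α - 1) ∣ m) :
    α ≤ (Nat.digits 2 m).sum := by
  induction m using Nat.strong_induction_on with
  | _ m ih =>
    have h2 : 2 ≤ 2 ^ α := by
      calc 2 = 2 ^ 1 := by norm_num
        _ ≤ 2 ^ α := Nat.pow_le_pow_right (by norm_num) hα
    by_cases hlt : m < 2 ^ α
    · have := Nat.le_of_dvd hm hdvd
      have e : m = 2 ^ α - 1 := by omega
      rw [e, bds_ones]
    · have hq : 0 < m / 2 ^ α := Nat.div_pos (by omega) (by omega)
      have hr : m % 2 ^ α < 2 ^ α := Nat.mod_lt _ (by omega)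
      have hd := Nat.div_add_mod m (2 ^ α)
      generalize m / 2 ^ α = q at *
      generalize m % 2 ^ α = r at *
      have hs := bds_split α q r hr
      have ha := bds_add (q + r) q r 0 le_rfl (by norm_num)
      have e : m = (2 ^ α - 1) * q + (q + r) := by
        rw [← hd, Nat.sub_mul]
        have : 1 * q ≤ 2 ^ α * q := Nat.mul_le_mul_right _ (by omega)
        omega
      have hpos : 0 < (2 ^ α - 1) * q := Nat.mul_pos (by omega) hq
      have hdv : (2 ^ α - 1) ∣ q + r := by
        rw [e] at hdvd
        exact (Nat.dvd_add_right (Dvd.intro _ rfl)).1 hdvd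
      have := ih (q + r) (by omega) (by omega) hdv
      rw [hd] at hs
      simp only [add_zero] at ha
      omega
end

section
/- Let S be a finite set of nonnegative integers and R a set of nonnegative integers such that every nonnegative integer can be written uniquely as s + r with s ∈ S, r ∈ R (i.e., S ⊕ R is a direct-sum tiling of the nonnegative integers). Then for every nonnegative integer v and every s ∈ S, there is exactly one element of the translate S + v = {s' + v : s' ∈ S} whose unique decomposition has S-component equal to s; i.e., each translate of S contains exactly one element from each class s + R. -/
/-- If `(S, R)` is a direct-sum tiling of `ℕ` (every natural number is uniquely
`s + r` with `s ∈ S`, `r ∈ R`), then for every `v : ℕ` and every `s ∈ S`, the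
translate `S + v` contains exactly one element from the class `s + R`. -/
theorem translate_meets_each_class_once (S : Finset ℕ) (R : Set ℕ)
    (htile : ∀ m : ℕ, ∃! p : ℕ × ℕ, p.1 ∈ S ∧ p.2 ∈ R ∧ p.1 + p.2 = m)
    (v : ℕ) (s : ℕ) (hs : s ∈ S) :
    ∃! m : ℕ, (∃ s' ∈ S, m = s' + v) ∧ (∃ r ∈ R, m = s + r) := by
  have key : ∀ t a b r q : ℕ, a ∈ S → b ∈ S → r ∈ R → q ∈ R →
      a + v = t + r → b + v = t + q → a = b := by
    intro t a b r q ha hb hr hq h1 h2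
    have h := (htile (a + q)).unique (y₁ := (a, q)) (y₂ := (b, r))
      ⟨ha, hq, rfl⟩ ⟨hb, hr, by simp only; omega⟩
    exact congrArg Prod.fst h
  choose f hf _ using htile
  have hsurj : Set.SurjOn (fun a => (f (a + v)).1) (S : Set ℕ) (S : Set ℕ) := by
    apply Finset.surjOn_of_injOn_of_card_le _ _ _ le_rfl
    · intro a _
      exact (hf (a + v)).1
    · intro a ha b hb hab
      have h1 := hf (a + v)
      have h2 := hf (b + v)
      simp only at hab
      exact key (f (a + v)).1 a b _ _ ha hb h1.2.1 h2.2.1 h1.2.2.symm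
        (by rw [hab]; exact h2.2.2.symm)
  obtain ⟨a, ha, hfa⟩ := hsurj hs
  simp only at hfa
  have h1 := hf (a + v)
  simp only [hfa] at h1
  refine ⟨a + v, ⟨⟨a, ha, rfl⟩, ⟨_, h1.2.1, h1.2.2.symm⟩⟩, ?_⟩
  rintro m ⟨⟨b, hb, rfl⟩, ⟨r, hr, hm⟩⟩
  rw [key s b a r _ hb ha hr h1.2.1 hm h1.2.2.symm]
end
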